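/- arXiv:1302.4804 — 2 statements merged into one kernel-verified Lean document; each statement's English description precedes it below -/
import Mathlib

section
/- Let Q1, Q2 be linearly independent quadratic forms on ℂ⁵ that vanish identically on a common 3-dimensional subspace of ℂ⁵ (the pencil contains a common plane of ℙ⁴), and suppose there is no nonzero v ∈ ℂ⁵ with A1v = A2v = 0 (no common singular point), where Ai is the symmetric matrix of Qi. Then there exists g ∈ GL(5,ℂ), acting by linear substitution of the variables a,b,c,d,e, such that span(Q1∘g, Q2∘g) equals either (1) span(ad−bc, be−cd), or (2) span(ad−μb², be−cd) for some μ ∈ ℂ. Moreover, for the pencil span(ad−bc, be−cd), the set of points [v] ∈ ℙ⁴ that are singular points of some nonzero member of the pencil is the conic {b=d=0, ae−c²=0}, while for the pencil span(ad−μb², be−cd) the singular points of the rank-4 members trace out the line {b=d=e=0}. -/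
open MvPolynomial

/-- The space of polynomials in the five variables `a,b,c,d,e` (indexed `0,…,4`). -/
abbrev Quin : Type := MvPolynomial (Fin 5) ℂ

/-- `m` is (the exponent vector of) a quadratic monomial. -/
def QuadMon (m : Fin 5 →₀ ℕ) : Prop := (m.sum fun _ n => n) = 2

/-- A net of quadrics: a 3-dimensional space of quadratic forms. -/
def IsNet (Λ : Submodule ℂ Quin) : Prop :=
  Module.finrank ℂ Λ = 3 ∧ ∀ Q ∈ Λ, MvPolynomial.IsHomogeneous Q 2

/-- The `ρ`-weight of a monomial. -/
def wt (ρ : Fin 5 → ℤ) (m : Fin 5 →₀ ℕ) : ℤ := ∑ i, (m i : ℤ) * ρ i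

/-- `Λ` is semistable with respect to the weight vector `ρ`: there are three distinct
quadratic monomials with total `ρ`-weight `≥ 0` such that the corresponding coefficient
map `Λ → ℂ³` is bijective. -/
def SemistableWrt (Λ : Submodule ℂ Quin) (ρ : Fin 5 → ℤ) : Prop :=
  ∃ m1 m2 m3 : Fin 5 →₀ ℕ, m1 ≠ m2 ∧ m1 ≠ m3 ∧ m2 ≠ m3 ∧
    QuadMon m1 ∧ QuadMon m2 ∧ QuadMon m3 ∧
    0 ≤ wt ρ m1 + wt ρ m2 + wt ρ m3 ∧
    Function.Bijective (fun Q : Λ =>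
      (![MvPolynomial.coeff m1 (Q : Quin), MvPolynomial.coeff m2 (Q : Quin),
         MvPolynomial.coeff m3 (Q : Quin)] : Fin 3 → ℂ))

/-- The twelve distinguished weight vectors `ρ1,…,ρ12`. -/
def rho : Fin 12 → Fin 5 → ℤ :=
  ![![1,1,1,1,-4], ![2,2,2,-3,-3], ![3,3,-2,-2,-2], ![4,-1,-1,-1,-1],
    ![3,3,3,-2,-7], ![4,4,-1,-1,-6], ![9,4,-1,-6,-6], ![7,2,2,-3,-8],
    ![12,7,2,-8,-13], ![9,4,-1,-1,-11], ![14,4,-1,-6,-11], ![13,8,3,-7,-17]]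

/-- A normalized weight vector: nonincreasing, sums to zero and not identically zero. -/
def IsNormalized (ρ : Fin 5 → ℤ) : Prop :=
  (∀ i j : Fin 5, i ≤ j → ρ j ≤ ρ i) ∧ (∑ i, ρ i) = 0 ∧ ρ ≠ 0

/-- Linear substitution of variables by the matrix `g`, as a linear map on polynomials. -/
noncomputable def substMap (g : Matrix (Fin 5) (Fin 5) ℂ) : Quin →ₗ[ℂ] Quin :=
  (MvPolynomial.aeval fun i => ∑ j, MvPolynomial.C (g i j) * MvPolynomial.X j).toLinearMap

/-- Semistability of a net (Hilbert–Mumford criterion for `SL(5)`). -/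
def Semistable (Λ : Submodule ℂ Quin) : Prop :=
  ∀ (g : Matrix.GeneralLinearGroup (Fin 5) ℂ) (ρ : Fin 5 → ℤ), IsNormalized ρ →
    SemistableWrt (Submodule.map (substMap (g : Matrix (Fin 5) (Fin 5) ℂ)) Λ) ρ

/-- The symmetric matrix of a quadratic form. -/
noncomputable def quadMatrix (Q : Quin) : Matrix (Fin 5) (Fin 5) ℂ :=
  Matrix.of fun i j =>
    if i = j then MvPolynomial.coeff (Finsupp.single i 2) Q
    else (1/2) * MvPolynomial.coeff (Finsupp.single i 1 + Finsupp.single j 1) Q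

/-- The discriminant quintic `det (x·A1 + y·A2 + z·A3)` of a net with basis `Q1,Q2,Q3`. -/
noncomputable def netDisc (Q1 Q2 Q3 : Quin) : MvPolynomial (Fin 3) ℂ :=
  Matrix.det (Matrix.of fun i j : Fin 5 =>
    MvPolynomial.C (quadMatrix Q1 i j) * MvPolynomial.X 0 +
    MvPolynomial.C (quadMatrix Q2 i j) * MvPolynomial.X 1 +
    MvPolynomial.C (quadMatrix Q3 i j) * MvPolynomial.X 2)

/-- The net lies on a smooth quartic del Pezzo surface. -/
def OnSmoothDelPezzo (Λ : Submodule ℂ Quin) : Prop :=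
  ∃ P1 P2 : Quin, P1 ∈ Λ ∧ P2 ∈ Λ ∧ LinearIndependent ℂ ![P1, P2] ∧
    ∀ v : Fin 5 → ℂ, v ≠ 0 → MvPolynomial.eval v P1 = 0 → MvPolynomial.eval v P2 = 0 →
      LinearIndependent ℂ
        ![fun i => MvPolynomial.eval v (MvPolynomial.pderiv i P1),
          fun i => MvPolynomial.eval v (MvPolynomial.pderiv i P2)]

/-- The Zariski topology on `ℂ⁵`, generated by the basic open sets `{v | p(v) ≠ 0}`. -/
def zariski5 : TopologicalSpace (Fin 5 → ℂ) :=
  TopologicalSpace.generateFrom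
    {u : Set (Fin 5 → ℂ) | ∃ p : Quin, u = {v | MvPolynomial.eval v p ≠ 0}}

/-- `ad − bc`. -/
noncomputable def pADBC : Quin :=
  MvPolynomial.X 0 * MvPolynomial.X 3 - MvPolynomial.X 1 * MvPolynomial.X 2

/-- `be − cd`. -/
noncomputable def pBECD : Quin :=
  MvPolynomial.X 1 * MvPolynomial.X 4 - MvPolynomial.X 2 * MvPolynomial.X 3

/-- `ad − μb²`. -/
noncomputable def pADmuB (μ : ℂ) : Quin :=
  MvPolynomial.X 0 * MvPolynomial.X 3 - MvPolynomial.C μ * MvPolynomial.X 1 ^ 2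

open LinearMap (BilinForm)

theorem quadMatrix_add (P Q : Quin) : quadMatrix (P + Q) = quadMatrix P + quadMatrix Q := by
  ext i j
  by_cases h : i = j <;> simp [quadMatrix, h, mul_add]

theorem quadMatrix_smul (c : ℂ) (Q : Quin) : quadMatrix (c • Q) = c • quadMatrix Q := by
  ext i j
  by_cases h : i = j <;> simp [quadMatrix, h]
  ring

theorem quadMatrix_apply_comm (Q : Quin) (i j : Fin 5) :
    quadMatrix Q i j = quadMatrix Q j i := by
  simp only [quadMatrix, Matrix.of_apply, eq_comm (a := j),
    add_comm (Finsupp.single j 1) (Finsupp.single i 1)]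
  split_ifs with h <;> simp [h]

/-- The symmetric bilinear form of a quadratic form, linearly in the quadratic form. -/
noncomputable def polarForm : Quin →ₗ[ℂ] BilinForm ℂ (Fin 5 → ℂ) where
  toFun Q := Matrix.toBilin' (quadMatrix Q)
  map_add' P Q := by rw [quadMatrix_add, map_add]
  map_smul' c Q := by rw [quadMatrix_smul, map_smul, RingHom.id_apply]

theorem polarForm_apply (Q : Quin) (v w : Fin 5 → ℂ) :
    polarForm Q v w = v ⬝ᵥ (quadMatrix Q).mulVec w :=
  Matrix.toBilin'_apply' _ _ _

theorem polarForm_comm (Q : Quin) (v w : Fin 5 → ℂ) : polarForm Q v w = polarForm Q w v := by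
  have h : (quadMatrix Q).transpose = quadMatrix Q := by
    ext i j
    exact quadMatrix_apply_comm Q j i
  rw [polarForm_apply, polarForm_apply, Matrix.dotProduct_mulVec, ← Matrix.mulVec_transpose, h,
    dotProduct_comm]

theorem quadMatrix_mulVec_eq_zero_iff (Q : Quin) (v : Fin 5 → ℂ) :
    (quadMatrix Q).mulVec v = 0 ↔ ∀ w, polarForm Q v w = 0 := by
  simp_rw [polarForm_comm Q v, polarForm_apply]
  refine ⟨fun h w => by rw [h, dotProduct_zero], fun h => ?_⟩
  ext i
  simpa using h (Pi.single i 1)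

theorem quadMatrix_monomial (p q i j : Fin 5) (c : ℂ) :
    quadMatrix (monomial (Finsupp.single p 1 + Finsupp.single q 1) c) i j =
      (c / 2) * ((if i = p ∧ j = q then 1 else 0) + if i = q ∧ j = p then 1 else 0) := by
  have h2 : Finsupp.single i 2 = (Finsupp.single i 1 + Finsupp.single i 1 : Fin 5 →₀ ℕ) := by
    rw [← Finsupp.single_add]
  simp only [quadMatrix, Matrix.of_apply, h2, coeff_monomial]
  simp only [Finsupp.single_add_single_eq_single_add_single (one_ne_zero (α := ℕ)) one_ne_zero]
  simp
  grind

theorem exists_eq_single_add_of_degree_eq_succ {σ : Type*} {m : σ →₀ ℕ} {n : ℕ}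
    (hm : m.degree = n + 1) : ∃ p m', m = Finsupp.single p 1 + m' ∧ m'.degree = n := by
  obtain ⟨p, hp⟩ : ∃ p, m p ≠ 0 := by
    by_contra! h
    simp [show m = 0 from Finsupp.ext h] at hm
  have hp' := Finsupp.single_le_iff.mpr (Nat.one_le_iff_ne_zero.mpr hp)
  refine ⟨p, m - Finsupp.single p 1, (add_tsub_cancel_of_le hp').symm, ?_⟩
  rw [← add_tsub_cancel_of_le hp', map_add, Finsupp.degree_single] at hm
  lia

theorem exists_single_add_single_of_degree_eq_two {σ : Type*} {m : σ →₀ ℕ} (hm : m.degree = 2) :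
    ∃ p q, m = Finsupp.single p 1 + Finsupp.single q 1 := by
  obtain ⟨p, m', rfl, hm'⟩ := exists_eq_single_add_of_degree_eq_succ hm
  obtain ⟨q, m'', rfl, hm''⟩ := exists_eq_single_add_of_degree_eq_succ hm'
  exact ⟨p, q, by rw [(Finsupp.degree_eq_zero_iff m'').mp hm'', add_zero]⟩

theorem eval_eq_polarForm {Q : Quin} (hQ : Q.IsHomogeneous 2) (v : Fin 5 → ℂ) :
    eval v Q = polarForm Q v v := by
  rw [Q.as_sum]
  simp only [map_sum, LinearMap.sum_apply]
  refine Finset.sum_congr rfl fun m hm => ?_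
  obtain ⟨p, q, hpq⟩ := exists_single_add_single_of_degree_eq_two (m := m)
    (by rw [Finsupp.degree_eq_weight_one]; exact hQ (mem_support_iff.mp hm))
  generalize coeff m Q = c
  subst hpq
  rw [polarForm_apply]
  simp only [dotProduct, Matrix.mulVec, quadMatrix_monomial, ite_and, mul_add, add_mul, mul_ite,
    ite_mul, mul_one, mul_zero, zero_mul, Finset.sum_add_distrib, Finset.mul_sum]
  simp [eval_monomial, Finsupp.prod_add_index', pow_add]
  ring

theorem eval_add_eq {Q : Quin} (hQ : Q.IsHomogeneous 2) (v w : Fin 5 → ℂ) :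
    eval (v + w) Q = eval v Q + eval w Q + 2 * polarForm Q v w := by
  simp only [eval_eq_polarForm hQ, map_add, LinearMap.add_apply, polarForm_comm Q w v]
  ring

theorem quadMatrix_mulVec_eq_zero_iff_eval {Q : Quin} (hQ : Q.IsHomogeneous 2) (v : Fin 5 → ℂ) :
    (quadMatrix Q).mulVec v = 0 ↔ ∀ w, eval (v + w) Q = eval v Q + eval w Q := by
  simp [quadMatrix_mulVec_eq_zero_iff, eval_add_eq hQ]

theorem eval_substMap (g : Matrix (Fin 5) (Fin 5) ℂ) (Q : Quin) (v : Fin 5 → ℂ) :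
    eval v (substMap g Q) = eval (g.mulVec v) Q := by
  simp only [substMap, AlgHom.toLinearMap_apply, aeval_def, ← coe_eval₂Hom, ← RingHom.comp_apply]
  congr 1
  ext i
  · simp
  · simp [Matrix.mulVec, dotProduct]

theorem span_pair_eq_of_det_ne_zero {K M : Type*} [Field K] [AddCommGroup M] [Module K M]
    (P : Matrix (Fin 2) (Fin 2) K) (hP : P.det ≠ 0) (x y : M) :
    Submodule.span K {P 0 0 • x + P 0 1 • y, P 1 0 • x + P 1 1 • y} = Submodule.span K {x, y} := by
  rw [Matrix.det_fin_two] at hP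
  apply le_antisymm <;> rw [Submodule.span_le, Set.pair_subset_iff]
  · exact ⟨Submodule.mem_span_pair.mpr ⟨_, _, rfl⟩, Submodule.mem_span_pair.mpr ⟨_, _, rfl⟩⟩
  · set d := P 0 0 * P 1 1 - P 0 1 * P 1 0
    refine ⟨Submodule.mem_span_pair.mpr ⟨P 1 1 / d, -P 0 1 / d, ?_⟩,
      Submodule.mem_span_pair.mpr ⟨-P 1 0 / d, P 0 0 / d, ?_⟩⟩
    · match_scalars <;> field_simp <;> ring
    · match_scalars <;> field_simp <;> ring

/-- A nonzero linear functional on `2 × 2` matrices becomes, after multiplication by invertible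
matrices on both sides, either `X ↦ X₀₀ - X₁₁` or `X ↦ X₀₀`. -/
theorem exists_normal_form_functional {K : Type*} [Field K]
    (f : Matrix (Fin 2) (Fin 2) K →ₗ[K] K) (hf : f ≠ 0) :
    ∃ (P R : Matrix (Fin 2) (Fin 2) K) (ν : K), P.det ≠ 0 ∧ R.det ≠ 0 ∧ (ν = 1 ∨ ν = 0) ∧
      ∀ X, f (P * X * R) = X 0 0 - ν * X 1 1 := by
  obtain ⟨N, hN⟩ : ∃ N : Matrix (Fin 2) (Fin 2) K, ∀ X, f X =
      N 0 0 * X 0 0 + N 0 1 * X 0 1 + N 1 0 * X 1 0 + N 1 1 * X 1 1 := by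
    refine ⟨Matrix.of fun i j => f (Matrix.single i j 1), fun X => ?_⟩
    conv_lhs => rw [Matrix.matrix_eq_sum_single X]
    have h : ∀ i j, f (Matrix.single i j (X i j)) = f (Matrix.single i j 1) * X i j := by
      intro i j
      rw [mul_comm, ← smul_eq_mul, ← map_smul, Matrix.smul_single, smul_eq_mul, mul_one]
    simp only [map_add, Fin.sum_univ_two, h, Matrix.of_apply, add_assoc]
  obtain ⟨p, q, r, s, rfl⟩ : ∃ p q r s, N = !![p, q; r, s] := ⟨_, _, _, _, N.eta_fin_two⟩
  simp only [Matrix.of_apply, Matrix.cons_val', Matrix.cons_val_zero, Matrix.cons_val_one,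
    Matrix.cons_val_fin_one] at hN
  by_cases hd : p * s - q * r = 0
  · have hne : p ≠ 0 ∨ q ≠ 0 ∨ r ≠ 0 ∨ s ≠ 0 := by
      by_contra! h
      exact hf (LinearMap.ext fun X => by simp [hN, h])
    rcases hne with h | h | h | h
    · refine ⟨!![1 / p, -r / p; 0, 1], !![1, 0; -q / p, 1], 0, by simp [h], by simp,
        Or.inr rfl, fun X => ?_⟩
      rw [hN, X.eta_fin_two]
      simp
      grind
    · refine ⟨!![1 / q, -s / q; 0, 1], !![0, 1; 1, -p / q], 0, by simp [h], by simp,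
        Or.inr rfl, fun X => ?_⟩
      rw [hN, X.eta_fin_two]
      simp
      grind
    · refine ⟨!![0, 1; 1 / r, -p / r], !![1, 0; -s / r, 1], 0, by simp [h], by simp,
        Or.inr rfl, fun X => ?_⟩
      rw [hN, X.eta_fin_two]
      simp
      grind
    · refine ⟨!![0, 1; 1 / s, -q / s], !![0, 1; 1, -r / s], 0, by simp [h], by simp,
        Or.inr rfl, fun X => ?_⟩
      rw [hN, X.eta_fin_two]
      simp
      grind
  · refine ⟨(p * s - q * r)⁻¹ • !![s, r; -q, -p], 1, 1, ?_, by simp, Or.inl rfl, fun X => ?_⟩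
    · simp [Matrix.det_fin_two]
      grind
    · rw [hN, X.eta_fin_two]
      simp
      grind

/-- If `W` is totally isotropic for two forms and the pairings of three of its vectors with `u₀`,
`u₁` are in normal form, then so are the two forms, after correcting `u₀`, `u₁` by vectors
of `W`. -/
theorem exists_family_of_pairing {V : Type*} [AddCommGroup V] [Module ℂ V] (B₀ B₁ : BilinForm ℂ V)
    (hs₀ : ∀ v w, B₀ v w = B₀ w v) (hs₁ : ∀ v w, B₁ v w = B₁ w v) (W : Submodule ℂ V)
    (hW₀ : ∀ v ∈ W, ∀ w ∈ W, B₀ v w = 0) (hW₁ : ∀ v ∈ W, ∀ w ∈ W, B₁ v w = 0)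
    (u₀ u₁ : V) (ν : ℂ) (hν : ν = 1 ∨ ν = 0)
    (hlift : ∀ X : Matrix (Fin 2) (Fin 2) ℂ, X 0 0 = ν * X 1 1 → ∃ w ∈ W,
      B₀ w u₀ = X 0 0 ∧ B₀ w u₁ = X 0 1 ∧ B₁ w u₀ = X 1 0 ∧ B₁ w u₁ = X 1 1) :
    ∃ (e : Fin 5 → V) (μ : ℂ), (ν = 1 → μ = 0) ∧ ∀ x : Fin 5 → ℂ,
      B₀ (∑ j, x j • e j) (∑ j, x j • e j) = x 0 * x 3 - ν * (x 1 * x 2) - μ * x 1 ^ 2 ∧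
      B₁ (∑ j, x j • e j) (∑ j, x j • e j) = x 1 * x 4 - x 2 * x 3 := by
  obtain ⟨wa, ha, ha00, ha01, ha10, ha11⟩ := hlift !![0, 1 / 2; 0, 0] (by simp)
  obtain ⟨wc, hc, hc00, hc01, hc10, hc11⟩ := hlift !![-ν / 2, 0; 0, -1 / 2] (by simp; ring)
  obtain ⟨we, he, he00, he01, he10, he11⟩ := hlift !![0, 0; 1 / 2, 0] (by simp)
  obtain ⟨w, hw, hw00, hw01, hw10, hw11⟩ := hlift
    !![-ν * B₀ u₀ u₀ / 2, (ν * B₁ u₁ u₁ - 2 * B₀ u₀ u₁) / 2; -B₁ u₀ u₀ / 2, -ν * B₀ u₀ u₀ / 2]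
    (by rcases hν with rfl | rfl <;> simp)
  obtain ⟨w', hw', hw'00, hw'01, hw'10, hw'11⟩ := hlift
    !![-ν * B₁ u₁ u₁ / 2, -B₀ u₁ u₁ / 2; (ν * B₀ u₀ u₀ - 2 * B₁ u₀ u₁) / 2, -B₁ u₁ u₁ / 2]
    (by simp; ring)
  simp only [Matrix.of_apply, Matrix.cons_val', Matrix.cons_val_zero, Matrix.cons_val_one,
    Matrix.cons_val_fin_one] at *
  refine ⟨![wa, u₀ + w, wc, u₁ + w', we], -(1 - ν) * B₀ u₀ u₀, fun h => by simp [h], fun x => ?_⟩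
  simp only [Fin.sum_univ_five, Matrix.cons_val, map_add, map_smul, LinearMap.add_apply,
    LinearMap.smul_apply, smul_eq_mul, smul_add]
  simp only [hs₀ u₁ u₀, hs₁ u₁ u₀,
    hs₀ u₀ wa, hs₀ u₀ wc, hs₀ u₀ we, hs₀ u₀ w, hs₀ u₀ w',
    hs₀ u₁ wa, hs₀ u₁ wc, hs₀ u₁ we, hs₀ u₁ w, hs₀ u₁ w',
    hs₁ u₀ wa, hs₁ u₀ wc, hs₁ u₀ we, hs₁ u₀ w, hs₁ u₀ w',
    hs₁ u₁ wa, hs₁ u₁ wc, hs₁ u₁ we, hs₁ u₁ w, hs₁ u₁ w',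
    ha00, ha01, ha10, ha11, hc00, hc01, hc10, hc11,
    he00, he01, he10, he11, hw00, hw01, hw10, hw11, hw'00, hw'01, hw'10, hw'11,
    hW₀, hW₁, ha, hc, he, hw, hw']
  rcases hν with rfl | rfl <;> constructor <;> ring

/-- Two forms on a five-dimensional space with a common totally isotropic subspace of dimension
three and no common kernel are, after a change of basis of the pencil, in normal form on some
family of five vectors. -/
theorem exists_normal_form {V : Type*} [AddCommGroup V] [Module ℂ V] [FiniteDimensional ℂ V]
    (hV : Module.finrank ℂ V = 5) (B : Fin 2 → BilinForm ℂ V)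
    (hs : ∀ i v w, B i v w = B i w v) (W : Submodule ℂ V) (hW : Module.finrank ℂ W = 3)
    (hBW : ∀ i, ∀ v ∈ W, ∀ w ∈ W, B i v w = 0)
    (hker : ∀ v, (∀ i w, B i v w = 0) → v = 0) :
    ∃ (P : Matrix (Fin 2) (Fin 2) ℂ) (e : Fin 5 → V) (ν μ : ℂ), P.det ≠ 0 ∧
      (ν = 1 ∨ ν = 0) ∧ (ν = 1 → μ = 0) ∧ ∀ x : Fin 5 → ℂ,
      P 0 0 * B 0 (∑ j, x j • e j) (∑ j, x j • e j) +
          P 0 1 * B 1 (∑ j, x j • e j) (∑ j, x j • e j) =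
        x 0 * x 3 - ν * (x 1 * x 2) - μ * x 1 ^ 2 ∧
      P 1 0 * B 0 (∑ j, x j • e j) (∑ j, x j • e j) +
          P 1 1 * B 1 (∑ j, x j • e j) (∑ j, x j • e j) =
        x 1 * x 4 - x 2 * x 3 := by
  obtain ⟨U, hWU⟩ := W.exists_isCompl
  have hU : Module.finrank ℂ U = 2 := by
    have := Submodule.finrank_add_eq_of_isCompl hWU
    lia
  let b := Module.finBasisOfFinrankEq ℂ U hU
  let T : W →ₗ[ℂ] Matrix (Fin 2) (Fin 2) ℂ :=
    { toFun w := Matrix.of fun i k => B i w (b k)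
      map_add' v w := by ext; simp
      map_smul' c w := by ext; simp }
  have hT (w : W) (i k : Fin 2) : T w i k = B i w (b k) := rfl
  have hTinj : Function.Injective T := by
    rw [injective_iff_map_eq_zero]
    refine fun w hw => Subtype.ext (hker _ fun i v => ?_)
    obtain ⟨v₁, h₁, v₂, h₂, rfl⟩ :=
      Submodule.mem_sup.mp (hWU.sup_eq_top ▸ Submodule.mem_top (x := v))
    have hb : ∀ k, B i w (b k) = 0 := fun k => by rw [← hT, hw, Matrix.zero_apply]
    have h₂' : ((B i w).comp U.subtype) = 0 := b.ext fun k => by simpa using hb k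
    rw [map_add, hBW i w w.2 v₁ h₁, zero_add]
    exact LinearMap.congr_fun h₂' ⟨v₂, h₂⟩
  have hTrank : Module.finrank ℂ (LinearMap.range T) = 3 := by
    rw [LinearMap.finrank_range_of_inj hTinj, hW]
  have hM : Module.finrank ℂ (Matrix (Fin 2) (Fin 2) ℂ) = 4 := by
    simp [Module.finrank_matrix]
  obtain ⟨f, hf, hTf⟩ := Submodule.exists_le_ker_of_lt_top (LinearMap.range T) <|
    lt_top_iff_ne_top.mpr fun h => by
      rw [h, finrank_top] at hTrank
      lia
  have hrange : LinearMap.range T = LinearMap.ker f := by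
    refine Submodule.eq_of_le_of_finrank_eq hTf ?_
    have := Module.Dual.finrank_ker_add_one_of_ne_zero hf
    lia
  obtain ⟨P, R, ν, hP, hR, hν, hPR⟩ := exists_normal_form_functional f hf
  have hPP : P⁻¹ * P = 1 := Matrix.nonsing_inv_mul P hP.isUnit
  have hRR : R * R⁻¹ = 1 := Matrix.mul_nonsing_inv R hR.isUnit
  obtain ⟨e, μ, hμ, he⟩ := exists_family_of_pairing
    (P⁻¹ 0 0 • B 0 + P⁻¹ 0 1 • B 1) (P⁻¹ 1 0 • B 0 + P⁻¹ 1 1 • B 1)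
    (fun v w => by simp [hs _ v w]) (fun v w => by simp [hs _ v w]) W
    (fun v hv w hw => by simp [hBW _ v hv w hw]) (fun v hv w hw => by simp [hBW _ v hv w hw])
    (R⁻¹ 0 0 • (b 0 : V) + R⁻¹ 1 0 • (b 1 : V)) (R⁻¹ 0 1 • (b 0 : V) + R⁻¹ 1 1 • (b 1 : V)) ν hν
    (fun X hX => by
      obtain ⟨w, hw⟩ : P * X * R ∈ LinearMap.range T := by
        rw [hrange, LinearMap.mem_ker, hPR, hX, sub_self]
      have hXw : X = P⁻¹ * T w * R⁻¹ := by
        rw [hw, Matrix.mul_assoc, Matrix.mul_assoc, hRR, Matrix.mul_one, ← Matrix.mul_assoc, hPP,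
          Matrix.one_mul]
      refine ⟨w, w.2, ?_⟩
      rw [hXw]
      simp only [Matrix.mul_apply, Fin.sum_univ_two, hT, LinearMap.add_apply, LinearMap.smul_apply,
        map_add, map_smul, smul_eq_mul]
      refine ⟨?_, ?_, ?_, ?_⟩ <;> ring)
  exact ⟨P⁻¹, e, ν, μ, (Matrix.isUnit_nonsing_inv_det P hP.isUnit).ne_zero, hν, hμ, he⟩

theorem isHomogeneous_pADBC : pADBC.IsHomogeneous 2 :=
  ((isHomogeneous_X ℂ 0).mul (isHomogeneous_X ℂ 3)).sub
    ((isHomogeneous_X ℂ 1).mul (isHomogeneous_X ℂ 2))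

theorem isHomogeneous_pBECD : pBECD.IsHomogeneous 2 :=
  ((isHomogeneous_X ℂ 1).mul (isHomogeneous_X ℂ 4)).sub
    ((isHomogeneous_X ℂ 2).mul (isHomogeneous_X ℂ 3))

theorem isHomogeneous_pADmuB (μ : ℂ) : (pADmuB μ).IsHomogeneous 2 :=
  ((isHomogeneous_X ℂ 0).mul (isHomogeneous_X ℂ 3)).sub
    (((isHomogeneous_X ℂ 1).pow 2).C_mul μ)

theorem eval_pADBC (v : Fin 5 → ℂ) : eval v pADBC = v 0 * v 3 - v 1 * v 2 := by
  simp [pADBC]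

theorem eval_pBECD (v : Fin 5 → ℂ) : eval v pBECD = v 1 * v 4 - v 2 * v 3 := by
  simp [pBECD]

theorem eval_pADmuB (μ : ℂ) (v : Fin 5 → ℂ) :
    eval v (pADmuB μ) = v 0 * v 3 - μ * v 1 ^ 2 := by
  simp [pADmuB]

theorem isHomogeneous_smul_add_smul {σ R : Type*} [CommSemiring R] {n : ℕ}
    {P Q : MvPolynomial σ R} (hP : P.IsHomogeneous n) (hQ : Q.IsHomogeneous n) (s t : R) :
    (s • P + t • Q).IsHomogeneous n :=
  (homogeneousSubmodule σ R n).add_mem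
    ((homogeneousSubmodule σ R n).smul_mem s hP) ((homogeneousSubmodule σ R n).smul_mem t hQ)

theorem exists_span_substMap_eq (Q1 Q2 : Quin)
    (hQ1 : Q1.IsHomogeneous 2) (hQ2 : Q2.IsHomogeneous 2)
    (hplane : ∃ W : Submodule ℂ (Fin 5 → ℂ), Module.finrank ℂ W = 3 ∧
      ∀ w ∈ W, eval w Q1 = 0 ∧ eval w Q2 = 0)
    (hnosing : ¬ ∃ v : Fin 5 → ℂ, v ≠ 0 ∧
      (quadMatrix Q1).mulVec v = 0 ∧ (quadMatrix Q2).mulVec v = 0) :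
    ∃ g : Matrix.GeneralLinearGroup (Fin 5) ℂ,
      Submodule.span ℂ {substMap (g : Matrix (Fin 5) (Fin 5) ℂ) Q1,
          substMap (g : Matrix (Fin 5) (Fin 5) ℂ) Q2} =
        Submodule.span ℂ {pADBC, pBECD} ∨
      ∃ μ : ℂ,
        Submodule.span ℂ {substMap (g : Matrix (Fin 5) (Fin 5) ℂ) Q1,
            substMap (g : Matrix (Fin 5) (Fin 5) ℂ) Q2} =
          Submodule.span ℂ {pADmuB μ, pBECD} := by
  obtain ⟨W, hW, hQW⟩ := hplane
  have isotropic {Q : Quin} (hQ : Q.IsHomogeneous 2) (h : ∀ w ∈ W, eval w Q = 0) :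
      ∀ v ∈ W, ∀ w ∈ W, polarForm Q v w = 0 := fun v hv w hw => by
    simpa [h _ hv, h _ hw, h _ (W.add_mem hv hw)] using eval_add_eq hQ v w
  obtain ⟨P, e, ν, μ, hP, hν, hμ, he⟩ := exists_normal_form (by simp)
    ![polarForm Q1, polarForm Q2]
    (fun i v w => by fin_cases i <;> exact polarForm_comm _ v w) W hW
    (Fin.forall_fin_two.mpr ⟨isotropic hQ1 fun w hw => (hQW w hw).1,
      isotropic hQ2 fun w hw => (hQW w hw).2⟩)
    (fun v hv => by
      by_contra h0
      exact hnosing ⟨v, h0, (quadMatrix_mulVec_eq_zero_iff _ _).mpr (hv 0),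
        (quadMatrix_mulVec_eq_zero_iff _ _).mpr (hv 1)⟩)
  let g : Matrix (Fin 5) (Fin 5) ℂ := Matrix.of fun i j => e j i
  have hg (x : Fin 5 → ℂ) : ∑ j, x j • e j = g.mulVec x := by
    ext i
    simp [g, Matrix.mulVec, dotProduct, mul_comm]
  simp only [hg, Matrix.cons_val_zero, Matrix.cons_val_one, Matrix.cons_val_fin_one,
    ← eval_eq_polarForm hQ1, ← eval_eq_polarForm hQ2] at he
  have hinj : ∀ v, g.mulVec v = 0 → v = 0 := by
    intro v hv
    have key (x : Fin 5 → ℂ) := by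
      have h := he (v + x)
      rw [Matrix.mulVec_add, hv, zero_add, (he x).1, (he x).2] at h
      exact h
    have h0 := key (Pi.single 0 1)
    have h1 := key (Pi.single 1 1)
    have h3 := key (Pi.single 3 1)
    have h4 := key (Pi.single 4 1)
    have h := key 0
    simp at h h0 h1 h3 h4
    ext i
    fin_cases i <;> simp <;> grind
  have hdet : g.det ≠ 0 := fun h => by
    obtain ⟨v, hv, hgv⟩ := Matrix.exists_mulVec_eq_zero_iff.mpr h
    exact hv (hinj v hgv)
  refine ⟨Matrix.GeneralLinearGroup.mkOfDetNeZero g hdet, ?_⟩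
  rw [show ((Matrix.GeneralLinearGroup.mkOfDetNeZero g hdet : Matrix.GeneralLinearGroup _ ℂ) :
    Matrix (Fin 5) (Fin 5) ℂ) = g from rfl, ← span_pair_eq_of_det_ne_zero P hP]
  have hB : P 1 0 • substMap g Q1 + P 1 1 • substMap g Q2 = pBECD :=
    MvPolynomial.funext fun x => by simp [smul_eval, eval_substMap, eval_pBECD, (he x).2]
  rw [hB]
  rcases hν with rfl | rfl
  · left
    congr 2
    exact MvPolynomial.funext fun x => by
      simp [smul_eval, eval_substMap, eval_pADBC, (he x).1, hμ rfl]
  · right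
    refine ⟨μ, ?_⟩
    congr 2
    exact MvPolynomial.funext fun x => by
      simp [smul_eval, eval_substMap, eval_pADmuB, (he x).1]

theorem singular_points_pADBC_pBECD :
    {v : Fin 5 → ℂ | v ≠ 0 ∧ ∃ Q ∈ Submodule.span ℂ {pADBC, pBECD}, Q ≠ 0 ∧
        (quadMatrix Q).mulVec v = 0} =
      {v : Fin 5 → ℂ | v ≠ 0 ∧ v 1 = 0 ∧ v 3 = 0 ∧ v 0 * v 4 - v 2 ^ 2 = 0} := by
  have hsing (s t : ℂ) (v : Fin 5 → ℂ) :
      (quadMatrix (s • pADBC + t • pBECD)).mulVec v = 0 ↔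
        s * v 3 = 0 ∧ t * v 1 = 0 ∧ s * v 1 + t * v 3 = 0 ∧ t * v 4 = s * v 2 ∧
          s * v 0 = t * v 2 := by
    rw [quadMatrix_mulVec_eq_zero_iff_eval
      (isHomogeneous_smul_add_smul isHomogeneous_pADBC isHomogeneous_pBECD s t)]
    simp only [map_add, smul_eval, eval_pADBC, eval_pBECD, Pi.add_apply]
    refine ⟨fun h => ?_, fun ⟨h0, h4, h2, h1, h3⟩ w => ?_⟩
    · have hz := h 0
      have h0 := h (Pi.single 0 1)
      have h1 := h (Pi.single 1 1)
      have h2 := h (Pi.single 2 1)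
      have h3 := h (Pi.single 3 1)
      have h4 := h (Pi.single 4 1)
      simp at hz h0 h1 h2 h3 h4
      grind
    · linear_combination w 0 * h0 + w 1 * h1 - w 2 * h2 + w 3 * h3 + w 4 * h4
  ext v
  refine and_congr_right fun hv => ⟨?_, ?_⟩
  · rintro ⟨Q, hQ, hQ0, hQv⟩
    obtain ⟨s, t, rfl⟩ := Submodule.mem_span_pair.mp hQ
    rw [hsing] at hQv
    have hst : s ≠ 0 ∨ t ≠ 0 := by
      by_contra! h
      simp [h] at hQ0
    grind
  · rintro ⟨h1, h3, h⟩
    obtain ⟨s, t, hst, h4, h0⟩ : ∃ s t : ℂ, (s ≠ 0 ∨ t ≠ 0) ∧ t * v 4 = s * v 2 ∧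
        s * v 0 = t * v 2 := by
      by_cases h24 : v 4 ≠ 0 ∨ v 2 ≠ 0
      · exact ⟨v 4, v 2, h24, by ring, by linear_combination h⟩
      · push Not at h24
        exact ⟨0, 1, by simp, by simp [h24], by simp [h24]⟩
    refine ⟨s • pADBC + t • pBECD, Submodule.mem_span_pair.mpr ⟨s, t, rfl⟩, fun hQ => ?_,
      (hsing s t v).mpr (by simp [h1, h3, h4, h0])⟩
    have e0 := congrArg (eval ![1, 0, 0, 1, 0]) hQ
    have e1 := congrArg (eval ![0, 1, 0, 0, 1]) hQ
    simp [smul_eval, eval_pADBC, eval_pBECD] at e0 e1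
    grind

theorem isOpen_of_isOpen_zariski5 {u : Set (Fin 5 → ℂ)} (hu : @IsOpen _ zariski5 u) : IsOpen u := by
  refine (le_generateFrom ?_ : Pi.topologicalSpace ≤ zariski5) u hu
  rintro _ ⟨p, rfl⟩
  exact isOpen_ne_fun (MvPolynomial.continuous_eval p) continuous_const

theorem singular_points_pADmuB_pBECD (μ : ℂ) :
    {v : Fin 5 → ℂ | v ≠ 0 ∧ ∃ Q ∈ Submodule.span ℂ {pADmuB μ, pBECD},
        (quadMatrix Q).rank = 4 ∧ (quadMatrix Q).mulVec v = 0} =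
      {v : Fin 5 → ℂ | v 0 ≠ 0 ∧ v 1 = 0 ∧ v 3 = 0 ∧ v 4 = 0} := by
  have hsing (s t : ℂ) (v : Fin 5 → ℂ) :
      (quadMatrix (s • pADmuB μ + t • pBECD)).mulVec v = 0 ↔
        s * v 3 = 0 ∧ t * v 1 = 0 ∧ t * v 3 = 0 ∧ t * v 4 = 2 * s * μ * v 1 ∧
          s * v 0 = t * v 2 := by
    rw [quadMatrix_mulVec_eq_zero_iff_eval
      (isHomogeneous_smul_add_smul (isHomogeneous_pADmuB μ) isHomogeneous_pBECD s t)]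
    simp only [map_add, smul_eval, eval_pADmuB, eval_pBECD, Pi.add_apply]
    refine ⟨fun h => ?_, fun ⟨h0, h4, h2, h1, h3⟩ w => ?_⟩
    · have hz := h 0
      have h0 := h (Pi.single 0 1)
      have h1 := h (Pi.single 1 1)
      have h2 := h (Pi.single 2 1)
      have h3 := h (Pi.single 3 1)
      have h4 := h (Pi.single 4 1)
      simp at hz h0 h1 h2 h3 h4
      grind
    · linear_combination w 0 * h0 + w 1 * h1 - w 2 * h2 + w 3 * h3 + w 4 * h4
  have hrank (A : Matrix (Fin 5) (Fin 5) ℂ) :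
      A.rank + Module.finrank ℂ (LinearMap.ker A.mulVecLin) = 5 := by
    simpa [Matrix.rank] using! LinearMap.finrank_range_add_finrank_ker A.mulVecLin
  ext v
  constructor
  · rintro ⟨hv, Q, hQ, hQ4, hQv⟩
    obtain ⟨s, t, rfl⟩ := Submodule.mem_span_pair.mp hQ
    have hker : Module.finrank ℂ
        (LinearMap.ker (quadMatrix (s • pADmuB μ + t • pBECD)).mulVecLin) = 1 := by
      have := hrank (quadMatrix (s • pADmuB μ + t • pBECD))
      lia
    have ht : t ≠ 0 := by
      rintro rfl
      have h2 : Pi.single 2 1 ∈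
          LinearMap.ker (quadMatrix (s • pADmuB μ + (0 : ℂ) • pBECD)).mulVecLin := by
        rw [LinearMap.mem_ker, Matrix.mulVecLin_apply, hsing]
        simp
      have h4 : Pi.single 4 1 ∈
          LinearMap.ker (quadMatrix (s • pADmuB μ + (0 : ℂ) • pBECD)).mulVecLin := by
        rw [LinearMap.mem_ker, Matrix.mulVecLin_apply, hsing]
        simp
      obtain ⟨c, hc⟩ := (finrank_eq_one_iff_of_nonzero' ⟨_, h2⟩ (by simp)).mp hker ⟨_, h4⟩
      simpa using congrFun (congrArg Subtype.val hc) 4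
    rw [hsing] at hQv
    have h1 : v 1 = 0 := by grind
    have h3 : v 3 = 0 := by grind
    have h4 : v 4 = 0 := by grind
    refine ⟨fun h0 => hv ?_, h1, h3, h4⟩
    ext i
    fin_cases i <;> simp <;> grind
  · rintro ⟨h0, h1, h3, h4⟩
    have hv : v ≠ 0 := fun h => h0 (congrFun h 0)
    have hQv : (quadMatrix (v 2 • pADmuB μ + v 0 • pBECD)).mulVec v = 0 := by
      rw [hsing]
      simp [h1, h3, h4, mul_comm]
    refine ⟨hv, _, Submodule.mem_span_pair.mpr ⟨v 2, v 0, rfl⟩, ?_, hQv⟩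
    have hker : LinearMap.ker (quadMatrix (v 2 • pADmuB μ + v 0 • pBECD)).mulVecLin =
        Submodule.span ℂ {v} := by
      refine le_antisymm (fun w hw => ?_) ?_
      · rw [LinearMap.mem_ker, Matrix.mulVecLin_apply, hsing] at hw
        refine Submodule.mem_span_singleton.mpr ⟨w 0 / v 0, ?_⟩
        ext i
        fin_cases i <;> simp <;> grind
      · rw [Submodule.span_singleton_le_iff_mem]
        exact hQv
    have := hrank (quadMatrix (v 2 • pADmuB μ + v 0 • pBECD))
    rw [hker, finrank_span_singleton hv] at this
    lia

theorem zariski_closure_line :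
    @closure (Fin 5 → ℂ) zariski5 {v : Fin 5 → ℂ | v 0 ≠ 0 ∧ v 1 = 0 ∧ v 3 = 0 ∧ v 4 = 0} =
      {v : Fin 5 → ℂ | v 1 = 0 ∧ v 3 = 0 ∧ v 4 = 0} := by
  have hclosed (i : Fin 5) : @IsClosed _ zariski5 {v : Fin 5 → ℂ | v i = 0} :=
    @IsClosed.mk _ zariski5 _ (.basic _ ⟨X i, by ext; simp⟩)
  apply subset_antisymm
  · refine @closure_minimal _ zariski5 _ _ (fun v hv => hv.2) ?_
    exact @IsClosed.inter _ _ _ zariski5 (hclosed 1)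
      (@IsClosed.inter _ _ _ zariski5 (hclosed 3) (hclosed 4))
  · intro v hv
    refine (@mem_closure_iff _ zariski5 _ _).mpr fun u hu hvu => ?_
    have hcont : Continuous fun t : ℂ => Function.update v 0 t := by fun_prop
    obtain ⟨t, htu, ht⟩ := (dense_compl_singleton (0 : ℂ)).inter_open_nonempty _
      ((isOpen_of_isOpen_zariski5 hu).preimage hcont) ⟨v 0, by simpa using hvu⟩
    exact ⟨_, htu, by simpa using ⟨ht, hv⟩⟩

/-- A pencil of quadrics containing a common plane and with no common
singular point is projectively equivalent to `(ad − bc, be − cd)` or to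
`(ad − μb², be − cd)`.  Moreover, the singular points of the nonzero members of
`(ad − bc, be − cd)` trace out the conic `{b = d = 0, ae − c² = 0}`, and the singular
points of the rank-4 members of `(ad − μb², be − cd)` trace out (i.e. have Zariski
closure equal to) the line `{b = d = e = 0}`. -/
theorem pencil_with_common_plane (Q1 Q2 : Quin)
    (hQ1 : Q1.IsHomogeneous 2) (hQ2 : Q2.IsHomogeneous 2)
    (hli : LinearIndependent ℂ ![Q1, Q2])
    (hplane : ∃ W : Submodule ℂ (Fin 5 → ℂ), Module.finrank ℂ W = 3 ∧
      ∀ w ∈ W, MvPolynomial.eval w Q1 = 0 ∧ MvPolynomial.eval w Q2 = 0)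
    (hnosing : ¬ ∃ v : Fin 5 → ℂ, v ≠ 0 ∧
      (quadMatrix Q1).mulVec v = 0 ∧ (quadMatrix Q2).mulVec v = 0) :
    (∃ g : Matrix.GeneralLinearGroup (Fin 5) ℂ,
      Submodule.span ℂ {substMap (g : Matrix (Fin 5) (Fin 5) ℂ) Q1,
          substMap (g : Matrix (Fin 5) (Fin 5) ℂ) Q2} =
        Submodule.span ℂ {pADBC, pBECD} ∨
      ∃ μ : ℂ,
        Submodule.span ℂ {substMap (g : Matrix (Fin 5) (Fin 5) ℂ) Q1,
            substMap (g : Matrix (Fin 5) (Fin 5) ℂ) Q2} =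
          Submodule.span ℂ {pADmuB μ, pBECD}) ∧
    ({v : Fin 5 → ℂ | v ≠ 0 ∧ ∃ Q ∈ Submodule.span ℂ {pADBC, pBECD}, Q ≠ 0 ∧
        (quadMatrix Q).mulVec v = 0} =
      {v : Fin 5 → ℂ | v ≠ 0 ∧ v 1 = 0 ∧ v 3 = 0 ∧ v 0 * v 4 - v 2 ^ 2 = 0}) ∧
    (∀ μ : ℂ,
      @closure (Fin 5 → ℂ) zariski5
          {v : Fin 5 → ℂ | v ≠ 0 ∧ ∃ Q ∈ Submodule.span ℂ {pADmuB μ, pBECD},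
            (quadMatrix Q).rank = 4 ∧ (quadMatrix Q).mulVec v = 0} =
        {v : Fin 5 → ℂ | v 1 = 0 ∧ v 3 = 0 ∧ v 4 = 0}) := by
  exact ⟨exists_span_substMap_eq Q1 Q2 hQ1 hQ2 hplane hnosing, singular_points_pADBC_pBECD,
    fun μ => by rw [singular_points_pADmuB_pBECD, zariski_closure_line]⟩
end

section
/- Let Λ be a semi-stable net of quadrics in a,b,c,d,e with basis (Q1,Q2,Q3) and discriminant Δ = det(xA1+yA2+zA3). Then Δ is divisible by the square of a nonzero linear form in x,y,z (the discriminant quintic has a double line) if and only if there exist g ∈ GL(5,ℂ) and linear forms L1, L2 in a,b,c,d,e such that g·Λ = span(ad−bc, be−cd, ae−c²+bL1+dL2). -/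
open MvPolynomial

/-- The quadratic form `∑ A i j X_i X_j`. -/
noncomputable def quadForm (A : Matrix (Fin 5) (Fin 5) ℂ) : Quin :=
  ∑ i, ∑ j, C (A i j) * (X i * X j)

theorem quadForm_add (A B : Matrix (Fin 5) (Fin 5) ℂ) :
    quadForm (A + B) = quadForm A + quadForm B := by
  simp [quadForm, add_mul, Finset.sum_add_distrib]

theorem quadForm_smul (c : ℂ) (A : Matrix (Fin 5) (Fin 5) ℂ) :
    quadForm (c • A) = c • quadForm A := by
  simp [quadForm, Finset.smul_sum, MvPolynomial.smul_eq_C_mul, mul_assoc]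

theorem X_mul_X_eq_monomial (i j : Fin 5) :
    (X i * X j : Quin) = monomial (Finsupp.single i 1 + Finsupp.single j 1) 1 := by
  simp [X, monomial_mul]

theorem coeff_quadForm (A : Matrix (Fin 5) (Fin 5) ℂ) (m : Fin 5 →₀ ℕ) :
    coeff m (quadForm A) =
      ∑ i, ∑ j, if Finsupp.single i 1 + Finsupp.single j 1 = m then A i j else 0 := by
  simp [quadForm, coeff_sum, X_mul_X_eq_monomial, coeff_monomial, mul_ite]

theorem exists_of_coeff_quadForm_ne_zero {A : Matrix (Fin 5) (Fin 5) ℂ} {m : Fin 5 →₀ ℕ}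
    (h : coeff m (quadForm A) ≠ 0) :
    ∃ i j, A i j ≠ 0 ∧ Finsupp.single i 1 + Finsupp.single j 1 = m := by
  rw [coeff_quadForm] at h
  obtain ⟨i, -, hi⟩ := Finset.exists_ne_zero_of_sum_ne_zero h
  obtain ⟨j, -, hj⟩ := Finset.exists_ne_zero_of_sum_ne_zero hi
  by_cases hm : Finsupp.single i 1 + Finsupp.single j 1 = m
  · exact ⟨i, j, by simpa [hm] using hj, hm⟩
  · simp [hm] at hj

theorem coeff_quadForm_single_add_single (A : Matrix (Fin 5) (Fin 5) ℂ) (i j : Fin 5) :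
    coeff (Finsupp.single i 1 + Finsupp.single j 1) (quadForm A) =
      if i = j then A i i else A i j + A j i := by
  have key : ∀ k l : Fin 5, (Finsupp.single k 1 + Finsupp.single l 1 =
      (Finsupp.single i 1 + Finsupp.single j 1 : Fin 5 →₀ ℕ)) ↔
      (k = i ∧ l = j ∨ k = j ∧ l = i) := by
    intro k l
    rw [Finsupp.single_add_single_eq_single_add_single one_ne_zero one_ne_zero]
    simp
  rw [coeff_quadForm]
  simp only [key]
  fin_cases i <;> fin_cases j <;> simp [Fin.sum_univ_five] <;> exact add_comm _ _

theorem quadMatrix_isSymm (Q : Quin) : (quadMatrix Q).IsSymm := by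
  ext i j
  simp only [quadMatrix, Matrix.transpose_apply, Matrix.of_apply]
  by_cases h : i = j
  · subst h; simp
  · rw [if_neg h, if_neg (Ne.symm h), add_comm]

theorem quadMatrix_quadForm {A : Matrix (Fin 5) (Fin 5) ℂ} (hA : A.IsSymm) :
    quadMatrix (quadForm A) = A := by
  ext i j
  simp only [quadMatrix, Matrix.of_apply]
  have h2 : (Finsupp.single i 2 : Fin 5 →₀ ℕ) = Finsupp.single i 1 + Finsupp.single i 1 := by
    rw [← Finsupp.single_add]
  rw [h2, coeff_quadForm_single_add_single, coeff_quadForm_single_add_single, hA.apply i j]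
  by_cases h : i = j
  · subst h; simp
  · simp only [if_neg h]; simp; ring

theorem exists_single_add_single {m : Fin 5 →₀ ℕ} (hm : m.degree = 2) :
    ∃ i j, m = Finsupp.single i 1 + Finsupp.single j 1 := by
  have aux : ∀ (n : ℕ) (m : Fin 5 →₀ ℕ), m.degree = n + 1 →
      ∃ i m', m = Finsupp.single i 1 + m' ∧ m'.degree = n := by
    intro n m hm
    have : m ≠ 0 := by rintro rfl; simp at hm
    obtain ⟨i, hi⟩ := Finsupp.ne_iff.mp this
    have hle : Finsupp.single i 1 ≤ m := by
      rw [Finsupp.single_le_iff]; simpa [Nat.one_le_iff_ne_zero] using hi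
    refine ⟨i, m - Finsupp.single i 1, (add_tsub_cancel_of_le hle).symm, ?_⟩
    have h := congrArg Finsupp.degree (add_tsub_cancel_of_le hle)
    rw [map_add, Finsupp.degree_single, hm] at h
    omega
  obtain ⟨i, m', rfl, h1⟩ := aux 1 m hm
  obtain ⟨j, m'', rfl, h0⟩ := aux 0 m' h1
  rw [Finsupp.degree_eq_zero_iff] at h0
  exact ⟨i, j, by simp [h0]⟩

theorem isHomogeneous_quadForm (A : Matrix (Fin 5) (Fin 5) ℂ) :
    (quadForm A).IsHomogeneous 2 := by
  refine IsHomogeneous.sum _ _ _ fun i _ => IsHomogeneous.sum _ _ _ fun j _ => ?_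
  simpa using (isHomogeneous_C (Fin 5) (A i j)).mul
    ((isHomogeneous_X ℂ i).mul (isHomogeneous_X ℂ j))

theorem quadForm_quadMatrix {Q : Quin} (hQ : Q.IsHomogeneous 2) :
    quadForm (quadMatrix Q) = Q := by
  ext m
  by_cases hm : m.degree = 2
  · obtain ⟨i, j, rfl⟩ := exists_single_add_single hm
    rw [coeff_quadForm_single_add_single]
    by_cases h : i = j
    · subst h; simp [quadMatrix, ← Finsupp.single_add]
    · simp only [if_neg h, if_neg (Ne.symm h), quadMatrix, Matrix.of_apply]
      rw [add_comm (Finsupp.single j 1)]; ring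
  · rw [hQ.coeff_eq_zero hm, (isHomogeneous_quadForm _).coeff_eq_zero hm]

theorem substMap_quadForm (g A : Matrix (Fin 5) (Fin 5) ℂ) :
    substMap g (quadForm A) = quadForm (g.transpose * A * g) := by
  have h1 : substMap g (quadForm A) = ∑ i, ∑ j, ∑ k, ∑ l,
      C (A i j * g i k * g j l) * (X k * X l) := by
    simp only [substMap, quadForm, AlgHom.toLinearMap_apply, map_sum, map_mul, aeval_X,
      algHom_C, algebraMap_eq]
    refine Finset.sum_congr rfl fun i _ => Finset.sum_congr rfl fun j _ => ?_
    rw [Finset.sum_mul_sum, Finset.mul_sum]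
    refine Finset.sum_congr rfl fun k _ => ?_
    rw [Finset.mul_sum]
    refine Finset.sum_congr rfl fun l _ => ?_
    ring
  rw [h1]
  simp only [quadForm, Matrix.mul_apply, Matrix.transpose_apply, Finset.sum_mul, map_sum]
  calc _ = ∑ k, ∑ l, ∑ j, ∑ i, C (A i j * g i k * g j l) * (X k * X l : Quin) := by
        have := fun F : Fin 5 → Fin 5 → Fin 5 → Fin 5 → Quin => (calc
          ∑ i, ∑ j, ∑ k, ∑ l, F i j k l = ∑ i, ∑ k, ∑ j, ∑ l, F i j k l :=
            Finset.sum_congr rfl fun i _ => Finset.sum_comm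
          _ = ∑ k, ∑ i, ∑ j, ∑ l, F i j k l := Finset.sum_comm
          _ = ∑ k, ∑ i, ∑ l, ∑ j, F i j k l :=
            Finset.sum_congr rfl fun k _ => Finset.sum_congr rfl fun i _ => Finset.sum_comm
          _ = ∑ k, ∑ l, ∑ i, ∑ j, F i j k l :=
            Finset.sum_congr rfl fun k _ => Finset.sum_comm
          _ = ∑ k, ∑ l, ∑ j, ∑ i, F i j k l :=
            Finset.sum_congr rfl fun k _ => Finset.sum_congr rfl fun l _ => Finset.sum_comm)
        exact this _
    _ = _ := by
        refine Finset.sum_congr rfl fun k _ => Finset.sum_congr rfl fun l _ =>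
          Finset.sum_congr rfl fun j _ => Finset.sum_congr rfl fun i _ => ?_
        congr 2; ring

section

open Matrix

theorem wt_single_add_single (ρ : Fin 5 → ℤ) (i j : Fin 5) :
    wt ρ (Finsupp.single i 1 + Finsupp.single j 1) = ρ i + ρ j := by
  simp [wt, add_mul, Finset.sum_add_distrib, Finsupp.single_apply]

/-- The numerical criterion for the net spanned by the quadratic forms of `A 0, A 1, A 2`, in
terms of the Gram matrices of the `A k` in arbitrary bases `f` of `ℂ⁵`. -/
def MatrixSemistable (A : Fin 3 → Matrix (Fin 5) (Fin 5) ℂ) : Prop :=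
  ∀ f : Fin 5 → Fin 5 → ℂ, LinearIndependent ℂ f → ∀ ρ, IsNormalized ρ → ∀ w : Fin 3 → ℤ,
    (∀ k i j, f i ⬝ᵥ A k *ᵥ f j ≠ 0 → ρ i + ρ j ≤ w k) → 0 ≤ ∑ k, w k

theorem transpose_mul_mul_apply (f : Fin 5 → Fin 5 → ℂ) (A : Matrix (Fin 5) (Fin 5) ℂ)
    (i j : Fin 5) : (((of f)ᵀ)ᵀ * A * (of f)ᵀ) i j = f i ⬝ᵥ A *ᵥ f j := by
  rw [Matrix.mul_assoc, transpose_transpose, Matrix.mul_apply]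
  simp [dotProduct, mulVec, Matrix.mul_apply]

theorem isUnit_of_transpose {f : Fin 5 → Fin 5 → ℂ} (hf : LinearIndependent ℂ f) :
    IsUnit (of f)ᵀ := by
  rw [← Matrix.linearIndependent_cols_iff_isUnit]
  exact hf

theorem Semistable.matrixSemistable {Λ : Submodule ℂ Quin} (hss : Semistable Λ)
    {A : Fin 3 → Matrix (Fin 5) (Fin 5) ℂ}
    (hA : Λ = Submodule.span ℂ (Set.range fun k => quadForm (A k))) : MatrixSemistable A := by
  intro f hf ρ hρ w hw
  obtain ⟨g, hg⟩ := isUnit_of_transpose hf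
  obtain ⟨m1, m2, m3, -, -, -, -, -, -, hwt, -, hsurj⟩ := hss g ρ hρ
  rw [hg] at hsurj
  set m : Fin 3 → Fin 5 →₀ ℕ := ![m1, m2, m3] with hm
  set G := (of f)ᵀ
  let N : Matrix (Fin 3) (Fin 3) ℂ := of fun k l => coeff (m l) (quadForm (Gᵀ * A k * G))
  have hN : IsUnit N := by
    rw [← Matrix.vecMul_surjective_iff_isUnit]
    intro y
    obtain ⟨⟨Q, hQ⟩, hy⟩ := hsurj y
    rw [hA, Submodule.mem_map] at hQ
    obtain ⟨R, hR, rfl⟩ := hQ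
    obtain ⟨c, rfl⟩ := (Submodule.mem_span_range_iff_exists_fun ℂ).1 hR
    refine ⟨c, ?_⟩
    rw [← hy]
    ext l
    simp only [vecMul, dotProduct, N, of_apply, map_sum, map_smul, substMap_quadForm]
    fin_cases l <;> simp [hm, coeff_sum, G]
  have hdet : N.det ≠ 0 := ((Matrix.isUnit_iff_isUnit_det N).1 hN).ne_zero
  rw [Matrix.det_apply] at hdet
  obtain ⟨σ, -, hσ⟩ := Finset.exists_ne_zero_of_sum_ne_zero hdet
  have hprod : ∏ l, N (σ l) l ≠ 0 := fun h => hσ (by rw [h, smul_zero])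
  have hle : ∀ l, wt ρ (m l) ≤ w (σ l) := by
    intro l
    obtain ⟨i, j, hij, hml⟩ := exists_of_coeff_quadForm_ne_zero
      (Finset.prod_ne_zero_iff.1 hprod l (Finset.mem_univ l))
    rw [← hml, wt_single_add_single]
    rw [transpose_mul_mul_apply] at hij
    exact hw _ i j hij
  calc 0 ≤ wt ρ m1 + wt ρ m2 + wt ρ m3 := hwt
    _ = ∑ l, wt ρ (m l) := by simp [Fin.sum_univ_three, hm]
    _ ≤ ∑ l, w (σ l) := Finset.sum_le_sum fun l _ => hle l
    _ = ∑ k, w k := Equiv.sum_comp σ w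

theorem dotProduct_mulVec_comm {A : Matrix (Fin 5) (Fin 5) ℂ} (hA : A.IsSymm)
    (v w : Fin 5 → ℂ) : v ⬝ᵥ A *ᵥ w = w ⬝ᵥ A *ᵥ v := by
  rw [dotProduct_mulVec, ← mulVec_transpose, hA.eq, dotProduct_comm]

theorem exists_linearIndependent_cons {m : ℕ} {v : Fin m → Fin 5 → ℂ}
    (hv : LinearIndependent ℂ v) (S : Submodule ℂ (Fin 5 → ℂ)) (hS : m < Module.finrank ℂ S) :
    ∃ w ∈ S, LinearIndependent ℂ (vecCons w v) := by
  have : ¬ S ≤ Submodule.span ℂ (Set.range v) := by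
    intro h
    have h1 := Submodule.finrank_mono h
    rw [finrank_span_eq_card hv, Fintype.card_fin] at h1
    omega
  obtain ⟨w, hw, hw'⟩ := SetLike.not_le_iff_exists.1 this
  exact ⟨w, hw, linearIndependent_finCons.2 ⟨hv, hw'⟩⟩

theorem exists_linearIndependent_cons_of_lt {m : ℕ} {v : Fin m → Fin 5 → ℂ}
    (hv : LinearIndependent ℂ v) (hm : m < 5) : ∃ w, LinearIndependent ℂ (vecCons w v) := by
  obtain ⟨w, -, hw⟩ := exists_linearIndependent_cons hv ⊤ (by simpa using hm)
  exact ⟨w, hw⟩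

theorem exists_linearIndependent_cons_dotProduct_eq_zero {m : ℕ} {v : Fin m → Fin 5 → ℂ}
    (hv : LinearIndependent ℂ v) (hm : m < 4) (φ : Fin 5 → ℂ) :
    ∃ w, φ ⬝ᵥ w = 0 ∧ LinearIndependent ℂ (vecCons w v) := by
  let F : (Fin 5 → ℂ) →ₗ[ℂ] ℂ :=
    { toFun := fun x => φ ⬝ᵥ x
      map_add' := dotProduct_add φ
      map_smul' := fun c x => by simp }
  have h1 := F.finrank_range_add_finrank_ker
  have h2 := Submodule.finrank_le (LinearMap.range F)
  simp only [Module.finrank_self, Module.finrank_fin_fun] at h1 h2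
  obtain ⟨w, hw, hw'⟩ := exists_linearIndependent_cons hv (LinearMap.ker F) (by omega)
  exact ⟨w, hw, hw'⟩

theorem add_le_five_of_dotProduct_eq_zero {m n : ℕ} {v : Fin m → Fin 5 → ℂ}
    {φ : Fin n → Fin 5 → ℂ} (hv : LinearIndependent ℂ v) (hφ : LinearIndependent ℂ φ)
    (h : ∀ i j, φ i ⬝ᵥ v j = 0) : m + n ≤ 5 := by
  have h0 : of φ * (of v)ᵀ = 0 := by
    ext i j
    simpa [Matrix.mul_apply, dotProduct] using h i j
  have h1 := rank_add_rank_le_card_of_mul_eq_zero h0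
  rw [rank_transpose, LinearIndependent.rank_matrix (M := of φ) hφ,
    LinearIndependent.rank_matrix (M := of v) hv] at h1
  simp only [Fintype.card_fin] at h1
  omega

/-- The criterion for bases listed in order of increasing weights. -/
theorem MatrixSemistable.rev {A : Fin 3 → Matrix (Fin 5) (Fin 5) ℂ} (h : MatrixSemistable A)
    {f : Fin 5 → Fin 5 → ℂ} (hf : LinearIndependent ℂ f) (ρ : Fin 5 → ℤ)
    (hρ : IsNormalized (ρ ∘ Fin.rev)) (w : Fin 3 → ℤ)
    (hw : ∀ k i j, w k < ρ i + ρ j → f i ⬝ᵥ A k *ᵥ f j = 0) : 0 ≤ ∑ k, w k := by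
  refine h (f ∘ Fin.rev) (hf.comp _ Fin.rev_injective) _ hρ w fun k i j hij => ?_
  by_contra hlt
  exact hij (hw k _ _ (not_le.1 hlt))

section Destabilize

variable {A B D : Matrix (Fin 5) (Fin 5) ℂ}

theorem not_semistable_of_common_kernel (hA : A.IsSymm) (hB : B.IsSymm)
    (hss : MatrixSemistable ![A, B, D]) {v : Fin 5 → ℂ} (hv : v ≠ 0) (hAv : A *ᵥ v = 0)
    (hBv : B *ᵥ v = 0) (hDv : v ⬝ᵥ D *ᵥ v = 0) : False := by
  have h0 : LinearIndependent ℂ ![v] := by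
    simpa [linearIndependent_unique_iff] using hv
  obtain ⟨x1, h1⟩ := exists_linearIndependent_cons_of_lt h0 (by norm_num)
  obtain ⟨x2, h2⟩ := exists_linearIndependent_cons_of_lt h1 (by norm_num)
  obtain ⟨x3, h3⟩ := exists_linearIndependent_cons_of_lt h2 (by norm_num)
  obtain ⟨x4, h4⟩ := exists_linearIndependent_cons_of_lt h3 (by norm_num)
  have := hss.rev h4 ![-1, -1, -1, -1, 4] (by unfold IsNormalized; decide) ![-2, -2, 3] (by
    intro k i j
    fin_cases k <;> fin_cases i <;> fin_cases j <;>
      simp [hAv, hBv, hDv, dotProduct_mulVec_comm hA v, dotProduct_mulVec_comm hB v])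
  simp [Fin.sum_univ_three] at this

theorem not_semistable_of_common_kernel_two (hA : A.IsSymm) (hB : B.IsSymm)
    (hss : MatrixSemistable ![A, B, D]) {v w : Fin 5 → ℂ} (hv : LinearIndependent ℂ ![v, w])
    (hAv : A *ᵥ v = 0) (hBv : B *ᵥ v = 0) (hAw : A *ᵥ w = 0) (hBw : B *ᵥ w = 0) : False := by
  obtain ⟨x2, h2⟩ := exists_linearIndependent_cons_of_lt hv (by norm_num)
  obtain ⟨x3, h3⟩ := exists_linearIndependent_cons_of_lt h2 (by norm_num)
  obtain ⟨x4, h4⟩ := exists_linearIndependent_cons_of_lt h3 (by norm_num)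
  have := hss.rev h4 ![-2, -2, -2, 3, 3] (by unfold IsNormalized; decide) ![-4, -4, 6] (by
    intro k i j
    fin_cases k <;> fin_cases i <;> fin_cases j <;>
      simp [hAv, hBv, hAw, hBw, dotProduct_mulVec_comm hA v, dotProduct_mulVec_comm hB v,
        dotProduct_mulVec_comm hA w, dotProduct_mulVec_comm hB w])
  simp [Fin.sum_univ_three] at this

theorem not_semistable_of_isotropic_plane
    (hss : MatrixSemistable ![A, B, D]) {v : Fin 3 → Fin 5 → ℂ} (hv : LinearIndependent ℂ v)
    (hAv : ∀ i j, v i ⬝ᵥ A *ᵥ v j = 0) (hBv : ∀ i j, v i ⬝ᵥ B *ᵥ v j = 0)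
    (hDv : ∀ i j, v i ⬝ᵥ D *ᵥ v j = 0) : False := by
  obtain ⟨x3, h3⟩ := exists_linearIndependent_cons_of_lt hv (by norm_num)
  obtain ⟨x4, h4⟩ := exists_linearIndependent_cons_of_lt h3 (by norm_num)
  have := hss.rev h4 ![-3, -3, 2, 2, 2] (by unfold IsNormalized; decide) ![-1, -1, -1] (by
    intro k i j
    fin_cases k <;> fin_cases i <;> fin_cases j <;>
      simp [hAv, hBv, hDv])
  simp [Fin.sum_univ_three] at this

theorem not_semistable_of_isotropic_line (hA : A.IsSymm) (hB : B.IsSymm)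
    (hss : MatrixSemistable ![A, B, D]) {v w φ : Fin 5 → ℂ} (hv : LinearIndependent ℂ ![v, w])
    {a b c d : ℂ} (hAv : A *ᵥ v = a • φ) (hBv : B *ᵥ v = b • φ)
    (hAw : A *ᵥ w = c • φ) (hBw : B *ᵥ w = d • φ) (hφv : φ ⬝ᵥ v = 0) (hφw : φ ⬝ᵥ w = 0)
    (hDv : v ⬝ᵥ D *ᵥ v = 0) (hDvw : v ⬝ᵥ D *ᵥ w = 0) (hDwv : w ⬝ᵥ D *ᵥ v = 0)
    (hDw : w ⬝ᵥ D *ᵥ w = 0) : False := by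
  obtain ⟨x2, hx2, h2⟩ := exists_linearIndependent_cons_dotProduct_eq_zero hv (by norm_num) φ
  obtain ⟨x3, hx3, h3⟩ := exists_linearIndependent_cons_dotProduct_eq_zero h2 (by norm_num) φ
  obtain ⟨x4, h4⟩ := exists_linearIndependent_cons_of_lt h3 (by norm_num)
  rw [dotProduct_comm] at hφv hφw hx2 hx3
  have := hss.rev h4 ![-6, -1, -1, 4, 4] (by unfold IsNormalized; decide) ![-2, -2, 3] (by
    intro k i j
    fin_cases k <;> fin_cases i <;> fin_cases j <;>
      simp [hAv, hBv, hAw, hBw, hφv, hφw, hx2, hx3, hDv, hDvw, hDwv, hDw,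
        dotProduct_mulVec_comm hA v, dotProduct_mulVec_comm hB v,
        dotProduct_mulVec_comm hA w, dotProduct_mulVec_comm hB w])
  simp [Fin.sum_univ_three] at this

theorem not_semistable_of_isotropic_plane_of_rank_one (hA : A.IsSymm) (hB : B.IsSymm)
    (hss : MatrixSemistable ![A, B, D]) {u v w φ : Fin 5 → ℂ}
    (hv : LinearIndependent ℂ ![u, v, w]) {a b c d : ℂ} (hAu : A *ᵥ u = 0) (hBu : B *ᵥ u = 0)
    (hAv : A *ᵥ v = a • φ) (hBv : B *ᵥ v = b • φ) (hAw : A *ᵥ w = c • φ) (hBw : B *ᵥ w = d • φ)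
    (hφu : φ ⬝ᵥ u = 0) (hφv : φ ⬝ᵥ v = 0) (hφw : φ ⬝ᵥ w = 0) :
    False := by
  obtain ⟨x3, hx3, h3⟩ := exists_linearIndependent_cons_dotProduct_eq_zero hv (by norm_num) φ
  obtain ⟨x4, h4⟩ := exists_linearIndependent_cons_of_lt h3 (by norm_num)
  rw [dotProduct_comm] at hφu hφv hφw hx3
  have := hss.rev h4 ![-7, -2, 3, 3, 3] (by unfold IsNormalized; decide) ![-4, -4, 6] (by
    intro k i j
    fin_cases k <;> fin_cases i <;> fin_cases j <;>
      simp [hAu, hBu, hAv, hBv, hAw, hBw, hφu, hφv, hφw, hx3,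
        dotProduct_mulVec_comm hA u, dotProduct_mulVec_comm hB u,
        dotProduct_mulVec_comm hA v, dotProduct_mulVec_comm hB v,
        dotProduct_mulVec_comm hA w, dotProduct_mulVec_comm hB w])
  simp [Fin.sum_univ_three] at this

end Destabilize

theorem eventually_linearIndependent_mulVec {n : ℕ} {A B : Matrix (Fin 5) (Fin 5) ℂ}
    {r : Fin n → Fin 5 → ℂ} (hr : LinearIndependent ℂ fun j => A *ᵥ r j) :
    ∀ᶠ t : ℂ in nhds 0, LinearIndependent ℂ fun j => (A + t • B) *ᵥ r j := by
  have hc : Continuous fun t : ℂ => fun j => (A + t • B) *ᵥ r j := by fun_prop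
  exact hc.continuousAt.eventually
    (isOpen_setOfPred_linearIndependent.mem_nhds (by simpa using hr))

theorem exists_linearIndependent_mulVec (A : Matrix (Fin 5) (Fin 5) ℂ) :
    ∃ r : Fin A.rank → Fin 5 → ℂ, LinearIndependent ℂ fun j => A *ᵥ r j := by
  let b := Module.finBasis ℂ (LinearMap.range A.mulVecLin)
  choose r hr using fun j => (b j).2
  refine ⟨r, ?_⟩
  have := b.linearIndependent.map' _ (Submodule.ker_subtype (LinearMap.range A.mulVecLin))
  have heq : (fun j => A *ᵥ r j) = (LinearMap.range A.mulVecLin).subtype ∘ b := funext hr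
  rw [← heq] at this
  exact this

/-- If `A` has maximal rank in the pencil `A + tB`, a vector in the image of all other members of
the pencil lies in the image of `A`. -/
theorem exists_mulVec_eq_of_forall {A B : Matrix (Fin 5) (Fin 5) ℂ}
    (hr : ∀ t : ℂ, (A + t • B).rank ≤ A.rank) {b : Fin 5 → ℂ}
    (hb : ∀ t : ℂ, t ≠ 0 → ∃ w, (A + t • B) *ᵥ w = b) : ∃ v, A *ᵥ v = b := by
  by_contra hno
  obtain ⟨r, hli⟩ := exists_linearIndependent_mulVec A
  generalize hn : A.rank = n at r hli hr
  have h0 : LinearIndependent ℂ (vecCons b fun j => A *ᵥ r j) := by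
    refine linearIndependent_finCons.2 ⟨hli, fun h => hno ?_⟩
    have hle : Submodule.span ℂ (Set.range fun j => A *ᵥ r j) ≤ LinearMap.range A.mulVecLin := by
      rw [Submodule.span_le]
      rintro _ ⟨j, rfl⟩
      exact ⟨r j, rfl⟩
    exact hle h
  have hc : Continuous fun t : ℂ =>
      (vecCons b fun j => (A + t • B) *ᵥ r j : Fin (n + 1) → Fin 5 → ℂ) := by
    refine continuous_pi fun j => ?_
    refine Fin.cases ?_ (fun j => ?_) j
    · simp only [cons_val_zero]; fun_prop
    · simp only [cons_val_succ]; fun_prop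
  have hev : ∀ᶠ t : ℂ in nhds 0, LinearIndependent ℂ (vecCons b fun j => (A + t • B) *ᵥ r j) :=
    hc.continuousAt.eventually
      (isOpen_setOfPred_linearIndependent.mem_nhds (by simpa using h0))
  obtain ⟨t, ht, ht0⟩ := ((hev.filter_mono (nhdsWithin_le_nhds (s := {0}ᶜ))).and
    self_mem_nhdsWithin).exists
  obtain ⟨w, hw⟩ := hb t ht0
  have hle : Submodule.span ℂ (Set.range (vecCons b fun j => (A + t • B) *ᵥ r j)) ≤
      LinearMap.range (A + t • B).mulVecLin := by
    rw [Submodule.span_le]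
    rintro _ ⟨j, rfl⟩
    refine Fin.cases ?_ (fun j => ?_) j
    · exact ⟨w, hw⟩
    · exact ⟨r j, rfl⟩
  have h1 := Submodule.finrank_mono hle
  rw [finrank_span_eq_card ht, Fintype.card_fin] at h1
  have h2 := hr t
  simp only [Matrix.rank] at h1 h2
  omega

/-- Jordan chains starting at a kernel vector of a member of maximal rank extend indefinitely. -/
theorem exists_chain {A B : Matrix (Fin 5) (Fin 5) ℂ}
    (hr : ∀ t : ℂ, (A + t • B).rank ≤ A.rank) {k : Fin 5 → ℂ} (hk : A *ᵥ k = 0) (n : ℕ) :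
    ∃ v : ℕ → Fin 5 → ℂ, v 0 = k ∧ ∀ i < n, A *ᵥ v (i + 1) = - (B *ᵥ v i) := by
  induction n with
  | zero => exact ⟨fun _ => k, rfl, by simp⟩
  | succ n ih =>
    obtain ⟨v, hv0, hv⟩ := ih
    have htel : ∀ (t : ℂ) (m : ℕ), m ≤ n →
        (A + t • B) *ᵥ (∑ i ∈ Finset.range (m + 1), t ^ i • v i) = t ^ (m + 1) • (B *ᵥ v m) := by
      intro t m
      induction m with
      | zero => intro _; simp [hv0, add_mulVec, hk, smul_mulVec]
      | succ m ihm =>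
        intro hm
        rw [Finset.sum_range_succ, mulVec_add, ihm (by omega), add_mulVec, mulVec_smul,
          mulVec_smul, hv m (by omega), smul_mulVec, pow_succ t (m + 1)]
        module
    obtain ⟨x, hx⟩ := exists_mulVec_eq_of_forall hr (b := -(B *ᵥ v n)) fun t ht =>
      ⟨-((t ^ (n + 1))⁻¹ • ∑ i ∈ Finset.range (n + 1), t ^ i • v i), by
        rw [mulVec_neg, mulVec_smul, htel t n le_rfl, smul_smul,
          inv_mul_cancel₀ (pow_ne_zero _ ht), one_smul]⟩
    refine ⟨Function.update v (n + 1) x, by simp [hv0], fun i hi => ?_⟩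
    rcases Nat.lt_succ_iff_lt_or_eq.1 hi with hi | rfl
    · rw [Function.update_of_ne (by omega), Function.update_of_ne (by omega), hv i hi]
    · simpa using hx

/-- Jordan chains starting in the kernel are mutually isotropic. -/
theorem chain_isotropic {A B : Matrix (Fin 5) (Fin 5) ℂ} (hA : A.IsSymm) (hB : B.IsSymm)
    {v w : ℕ → Fin 5 → ℂ} {n : ℕ} (hv0 : A *ᵥ v 0 = 0)
    (hv : ∀ i < n, A *ᵥ v (i + 1) = - (B *ᵥ v i)) (hw : ∀ i < n, A *ᵥ w (i + 1) = - (B *ᵥ w i)) :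
    ∀ i j, i + j ≤ n → A *ᵥ v i ⬝ᵥ w j = 0 := by
  intro i
  induction i with
  | zero => intro j _; simp [hv0]
  | succ i ih =>
    intro j hij
    rw [hv i (by omega), neg_dotProduct, dotProduct_comm, dotProduct_mulVec_comm hB,
      ← dotProduct_neg, ← hw j (by omega), dotProduct_mulVec_comm hA, dotProduct_comm]
    exact ih (j + 1) (by omega)

/-- If `det (N + uE)` vanishes to second order at a matrix `N` of corank one, then the quadratic
form of `E` vanishes on the kernel of `N`. -/
theorem dotProduct_mulVec_eq_zero_of_det {N E : Matrix (Fin 5) (Fin 5) ℂ} (hN : N.IsSymm)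
    {r : Fin 4 → Fin 5 → ℂ} (hr : LinearIndependent ℂ fun j => N *ᵥ r j) {w : Fin 5 → ℂ}
    (hw : N *ᵥ w = 0) {h : ℂ → ℂ} (hh : Continuous h)
    (hdet : ∀ u : ℂ, (N + u • E).det = u ^ 2 * h u) : w ⬝ᵥ E *ᵥ w = 0 := by
  by_contra hne
  let G : ℂ → Matrix (Fin 5) (Fin 5) ℂ := fun u =>
    of (vecCons (E *ᵥ w) fun j => (N + u • E) *ᵥ r j)
  let P : Matrix (Fin 5) (Fin 5) ℂ := of (vecCons w r)
  have hGc : Continuous fun u => (G u).det := by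
    refine Continuous.matrix_det (continuous_pi fun j => ?_)
    refine Fin.cases ?_ (fun j => ?_) j
    · exact continuous_const
    · change Continuous fun u : ℂ => (N + u • E) *ᵥ r j
      fun_prop
  have hG0 : (G 0).det ≠ 0 := by
    have : LinearIndependent ℂ (G 0).row := by
      have : LinearIndependent ℂ (vecCons (E *ᵥ w) fun j => N *ᵥ r j) := by
        refine linearIndependent_finCons.2 ⟨hr, fun hmem => hne ?_⟩
        refine Submodule.span_induction (p := fun x _ => w ⬝ᵥ x = 0) ?_ (by simp) ?_ ?_ hmem
        · rintro _ ⟨j, rfl⟩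
          rw [dotProduct_mulVec_comm hN, hw, dotProduct_zero]
        · intro x y _ _ hx hy; rw [dotProduct_add, hx, hy, add_zero]
        · intro c x _ hx; rw [dotProduct_smul, hx, smul_zero]
      have hrow : (G 0).row = vecCons (E *ᵥ w) fun j => N *ᵥ r j := by
        simp only [G, zero_smul, add_zero]; rfl
      rwa [hrow]
    exact ((Matrix.isUnit_iff_isUnit_det _).1 (linearIndependent_rows_iff_isUnit.1 this)).ne_zero
  have hGu : ∀ u : ℂ, u ≠ 0 → (G u).det = u * h u * P.det := by
    intro u hu
    have h1 : P * (N + u • E)ᵀ = (G u).updateRow 0 (u • (E *ᵥ w)) := by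
      ext i j
      have h2 : (P * (N + u • E)ᵀ) i j = ((N + u • E) *ᵥ P i) j := by
        simp [Matrix.mul_apply, mulVec, dotProduct, mul_comm]
      rw [h2]
      refine Fin.cases ?_ (fun i => ?_) i
      · have hP : P 0 = w := rfl
        simp [hP, add_mulVec, hw, smul_mulVec]
      · have hP : P i.succ = r i := rfl
        have hG : G u i.succ = (N + u • E) *ᵥ r i := rfl
        rw [updateRow_ne (Fin.succ_ne_zero i), hP, hG]
    have h3 := congrArg Matrix.det h1
    have h4 : (G u).updateRow 0 (E *ᵥ w) = G u := by
      exact updateRow_eq_self (G u) 0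
    rw [det_mul, det_transpose, hdet, det_updateRow_smul, h4] at h3
    apply mul_left_cancel₀ hu
    rw [← h3]; ring
  apply hG0
  have hlim : (fun u => (G u).det) = fun u => u * h u * P.det := by
    refine Continuous.ext_on (dense_compl_singleton (0 : ℂ)) hGc (by fun_prop) ?_
    intro u hu
    exact hGu u hu
  simpa using congrFun hlim 0

theorem quartic_coeff_eq_zero {a b c d e : ℂ}
    (h : ∀ᶠ t : ℂ in nhds 0, a + b * t + c * t ^ 2 + d * t ^ 3 + e * t ^ 4 = 0) :
    a = 0 ∧ b = 0 ∧ c = 0 ∧ d = 0 ∧ e = 0 := by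
  let p : Polynomial ℂ := Polynomial.C a + Polynomial.C b * Polynomial.X +
    Polynomial.C c * Polynomial.X ^ 2 + Polynomial.C d * Polynomial.X ^ 3 +
    Polynomial.C e * Polynomial.X ^ 4
  have hp : p = 0 := by
    refine Polynomial.eq_zero_of_infinite_isRoot p ((infinite_of_mem_nhds 0 h).mono fun t ht => ?_)
    simpa [p] using ht
  have hc : ∀ n, p.coeff n = 0 := by simp [hp]
  refine ⟨?_, ?_, ?_, ?_, ?_⟩
  · simpa [p, Polynomial.coeff_X, Polynomial.coeff_C] using hc 0
  · simpa [p, Polynomial.coeff_X, Polynomial.coeff_C] using hc 1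
  · simpa [p, Polynomial.coeff_X, Polynomial.coeff_C] using hc 2
  · simpa [p, Polynomial.coeff_X, Polynomial.coeff_C] using hc 3
  · simpa [p, Polynomial.coeff_X, Polynomial.coeff_C] using hc 4

theorem linearIndependent_pair_of_notMem {x y : Fin 5 → ℂ} (hx : x ≠ 0)
    (hy : ∀ c : ℂ, y ≠ c • x) : LinearIndependent ℂ ![y, x] := by
  refine linearIndependent_finCons.2 ⟨by simpa [linearIndependent_unique_iff] using hx, ?_⟩
  simp only [range_cons, range_empty, Set.union_empty, Submodule.mem_span_singleton, not_exists]
  exact fun c hc => hy c hc.symm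

/-- If the images of `x₁, …, xₙ` are independent, they stay independent together with an independent
family of kernel vectors. -/
theorem linearIndependent_sum_of_mulVec {A : Matrix (Fin 5) (Fin 5) ℂ} {m n : ℕ}
    {x : Fin n → Fin 5 → ℂ} (hx : LinearIndependent ℂ fun j => A *ᵥ x j)
    {k : Fin m → Fin 5 → ℂ} (hk : LinearIndependent ℂ k) (hAk : ∀ i, A *ᵥ k i = 0) :
    LinearIndependent ℂ (Sum.elim x k) := by
  rw [Fintype.linearIndependent_iff]
  intro c hc
  rw [Fintype.sum_sum_type] at hc
  simp only [Sum.elim_inl, Sum.elim_inr] at hc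
  have h1 := congrArg (A *ᵥ ·) hc
  simp only [mulVec_add, mulVec_sum, mulVec_smul, hAk, smul_zero, Finset.sum_const_zero, add_zero,
    mulVec_zero] at h1
  have h2 := Fintype.linearIndependent_iff.1 hx _ h1
  simp only [h2, zero_smul, Finset.sum_const_zero, zero_add] at hc
  have h3 := Fintype.linearIndependent_iff.1 hk _ hc
  rintro (i | i)
  · exact h2 i
  · exact h3 i

theorem add_add_le_five {A : Matrix (Fin 5) (Fin 5) ℂ} {m n : ℕ}
    {x : Fin n → Fin 5 → ℂ} (hx : LinearIndependent ℂ fun j => A *ᵥ x j)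
    {k : Fin m → Fin 5 → ℂ} (hk : LinearIndependent ℂ k) (hAk : ∀ i, A *ᵥ k i = 0)
    (hA : A.IsSymm) (hiso : ∀ i j, A *ᵥ x i ⬝ᵥ x j = 0) : n + m + n ≤ 5 := by
  have h1 := linearIndependent_sum_of_mulVec hx hk hAk
  have h2 := h1.comp finSumFinEquiv.symm finSumFinEquiv.symm.injective
  refine add_le_five_of_dotProduct_eq_zero h2 hx fun i j => ?_
  simp only [Function.comp_apply]
  rcases finSumFinEquiv.symm j with j | j
  · exact hiso i j
  · rw [Sum.elim_inr, dotProduct_comm, dotProduct_mulVec_comm hA, hAk, dotProduct_zero]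

theorem false_of_two_le_finrank_ker {A B D : Matrix (Fin 5) (Fin 5) ℂ} (hA : A.IsSymm)
    (hB : B.IsSymm) (hss : MatrixSemistable ![A, B, D])
    (hr : ∀ t : ℂ, (A + t • B).rank ≤ A.rank) {k₀ k₁ : Fin 5 → ℂ}
    (hk : LinearIndependent ℂ ![k₀, k₁]) (hk₀ : A *ᵥ k₀ = 0) (hk₁ : A *ᵥ k₁ = 0) : False := by
  -- a common kernel vector `u` and a second kernel vector `v` of `A`
  obtain ⟨u, v, huv, hAu, hBu, hAv⟩ : ∃ u v, LinearIndependent ℂ ![u, v] ∧ A *ᵥ u = 0 ∧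
      B *ᵥ u = 0 ∧ A *ᵥ v = 0 := by
    by_cases hdep : LinearIndependent ℂ ![B *ᵥ k₀, B *ᵥ k₁]
    · exfalso
      obtain ⟨v, hv0, hv⟩ := exists_chain hr hk₀ 2
      obtain ⟨w, hw0, hw⟩ := exists_chain hr hk₁ 2
      have hAv0 : A *ᵥ v 0 = 0 := by rw [hv0, hk₀]
      have hAw0 : A *ᵥ w 0 = 0 := by rw [hw0, hk₁]
      have hx : LinearIndependent ℂ fun j => A *ᵥ (![v 1, w 1] j) := by
        rw [LinearIndependent.pair_iff] at hdep
        have : (fun j => A *ᵥ (![v 1, w 1] j)) = ![A *ᵥ v 1, A *ᵥ w 1] := by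
          ext i j; fin_cases i <;> rfl
        rw [this, LinearIndependent.pair_iff, hv 0 (by norm_num), hw 0 (by norm_num), hv0, hw0]
        intro s t hst
        refine hdep s t ?_
        rw [smul_neg, smul_neg, ← neg_add, neg_eq_zero] at hst
        exact hst
      have := add_add_le_five hx hk (by intro i; fin_cases i <;> simpa) hA (by
        have h1 := chain_isotropic hA hB hAv0 hv hv 1 1 le_rfl
        have h2 := chain_isotropic hA hB hAv0 hv hw 1 1 le_rfl
        have h3 := chain_isotropic hA hB hAw0 hw hv 1 1 le_rfl
        have h4 := chain_isotropic hA hB hAw0 hw hw 1 1 le_rfl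
        intro i j
        fin_cases i <;> fin_cases j <;> assumption)
      omega
    · rw [LinearIndependent.pair_iff] at hdep hk
      push Not at hdep
      obtain ⟨s, t, hst, hne⟩ := hdep
      have hB0 : B *ᵥ (s • k₀ + t • k₁) = 0 := by simpa [mulVec_add, mulVec_smul] using hst
      have hA0 : A *ᵥ (s • k₀ + t • k₁) = 0 := by simp [mulVec_add, mulVec_smul, hk₀, hk₁]
      by_cases hs : s = 0
      · refine ⟨_, k₀, ?_, hA0, hB0, hk₀⟩
        rw [LinearIndependent.pair_iff]
        intro p q hpq
        have := hk (p * s + q) (p * t) (by rw [← hpq]; module)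
        have hp : p = 0 := by simpa [hne hs] using this.2
        exact ⟨hp, by simpa [hp] using this.1⟩
      · refine ⟨_, k₁, ?_, hA0, hB0, hk₁⟩
        rw [LinearIndependent.pair_iff]
        intro p q hpq
        have := hk (p * s) (p * t + q) (by rw [← hpq]; module)
        have hp : p = 0 := by simpa [hs] using this.1
        exact ⟨hp, by simpa [hp] using this.2⟩
  obtain ⟨c, hc0, hc⟩ := exists_chain hr hAv 4
  have hAc0 : A *ᵥ c 0 = 0 := by rw [hc0, hAv]
  have hc1 := hc 0 (by norm_num)
  have hc2 := hc 1 (by norm_num)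
  simp only [zero_add, one_add_one_eq_two] at hc1 hc2
  have hiso := chain_isotropic hA hB hAc0 hc hc
  by_cases hφ : A *ᵥ c 1 = 0
  · rw [hφ, hc0, eq_comm, neg_eq_zero] at hc1
    exact not_semistable_of_common_kernel_two hA hB hss huv hAu hBu hAv hc1
  by_cases hφ2 : ∃ μ : ℂ, A *ᵥ c 2 = μ • A *ᵥ c 1
  · obtain ⟨μ, hμ⟩ := hφ2
    have hli : LinearIndependent ℂ ![u, v, c 1] := by
      have hx : LinearIndependent ℂ fun j => A *ᵥ (![c 1] j) := by
        simpa [linearIndependent_unique_iff] using hφ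
      have := (linearIndependent_sum_of_mulVec hx huv (by intro i; fin_cases i <;> simpa)).comp
        (![Sum.inr 0, Sum.inr 1, Sum.inl 0] : Fin 3 → Fin 1 ⊕ Fin 2) (by decide)
      convert this using 1
      ext i j; fin_cases i <;> rfl
    refine not_semistable_of_isotropic_plane_of_rank_one hA hB hss (φ := A *ᵥ c 1) hli hAu hBu
      (a := 0) (b := -1) (c := 1) (d := -μ) (by simpa) ?_ (by simp) ?_ ?_ ?_ (hiso 1 1 (by norm_num))
    · rw [hc1, hc0]; simp
    · rw [neg_smul, ← hμ, hc2, neg_neg]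
    · rw [dotProduct_comm, dotProduct_mulVec_comm hA, hAu, dotProduct_zero]
    · rw [dotProduct_comm, dotProduct_mulVec_comm hA, hAv, dotProduct_zero]
  · push Not at hφ2
    have hx : LinearIndependent ℂ fun j => A *ᵥ (![c 2, c 1] j) := by
      have := linearIndependent_pair_of_notMem hφ hφ2
      convert this using 1
      ext i j; fin_cases i <;> rfl
    have := add_add_le_five hx huv (by intro i; fin_cases i <;> simpa) hA (by
      have h1 := hiso 1 1 (by norm_num)
      have h2 := hiso 1 2 (by norm_num)
      have h3 := hiso 2 1 (by norm_num)
      have h4 := hiso 2 2 (by norm_num)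
      intro i j
      fin_cases i <;> fin_cases j <;> assumption)
    omega

/-- The matrix of the quadratic form `ad - bc`. -/
noncomputable def normalMatrix₁ : Matrix (Fin 5) (Fin 5) ℂ :=
  !![0, 0, 0, 1/2, 0; 0, 0, -1/2, 0, 0; 0, -1/2, 0, 0, 0; 1/2, 0, 0, 0, 0; 0, 0, 0, 0, 0]

/-- The matrix of the quadratic form `be - cd`. -/
noncomputable def normalMatrix₂ : Matrix (Fin 5) (Fin 5) ℂ :=
  !![0, 0, 0, 0, 0; 0, 0, 0, 0, 1/2; 0, 0, 0, -1/2, 0; 0, 0, -1/2, 0, 0; 0, 1/2, 0, 0, 0]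

/-- The matrix of the quadratic form `ae - c² + bL₁ + dL₂`, where `p` and `q` are the coefficients
of the linear forms `L₁` and `L₂`. -/
noncomputable def normalMatrix₃ (p q : Fin 5 → ℂ) : Matrix (Fin 5) (Fin 5) ℂ :=
  !![0, p 0 / 2, 0, q 0 / 2, 1/2; p 0 / 2, p 1, p 2 / 2, (p 3 + q 1) / 2, p 4 / 2;
    0, p 2 / 2, -1, q 2 / 2, 0; q 0 / 2, (p 3 + q 1) / 2, q 2 / 2, q 3, q 4 / 2;
    1/2, p 4 / 2, 0, q 4 / 2, 0]

theorem normalMatrix₁_isSymm : normalMatrix₁.IsSymm := by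
  ext i j
  fin_cases i <;> fin_cases j <;> rfl

theorem normalMatrix₂_isSymm : normalMatrix₂.IsSymm := by
  ext i j
  fin_cases i <;> fin_cases j <;> rfl

theorem normalMatrix₃_isSymm (p q : Fin 5 → ℂ) : (normalMatrix₃ p q).IsSymm := by
  ext i j
  fin_cases i <;> fin_cases j <;> rfl

theorem two_mul_C_div_two (r : ℂ) : 2 * (C (r / 2) : Quin) = C r := by
  rw [← map_ofNat C, ← C_mul, mul_div_cancel₀ r two_ne_zero]

theorem quadForm_normalMatrix₁ : quadForm normalMatrix₁ = X 0 * X 3 - X 1 * X 2 := by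
  have h := two_mul_C_div_two 1
  simp only [quadForm, normalMatrix₁, Fin.sum_univ_five, of_apply, cons_val, neg_div, C_neg, C_0,
    C_1] at h ⊢
  linear_combination (X 0 * X 3 - X 1 * X 2) * h

theorem quadForm_normalMatrix₂ : quadForm normalMatrix₂ = X 1 * X 4 - X 2 * X 3 := by
  have h := two_mul_C_div_two 1
  simp only [quadForm, normalMatrix₂, Fin.sum_univ_five, of_apply, cons_val, neg_div, C_neg, C_0,
    C_1] at h ⊢
  linear_combination (X 1 * X 4 - X 2 * X 3) * h

theorem quadForm_normalMatrix₃ (p q : Fin 5 → ℂ) :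
    quadForm (normalMatrix₃ p q) =
      X 0 * X 4 - X 2 ^ 2 + X 1 * ∑ i, C (p i) * X i + X 3 * ∑ i, C (q i) * X i := by
  have h := two_mul_C_div_two
  have h1 := h 1
  simp only [quadForm, normalMatrix₃, Fin.sum_univ_five, of_apply, cons_val, C_neg, C_0,
    C_1, add_div, C_add] at h1 ⊢
  linear_combination X 0 * X 4 * h1 + X 0 * X 1 * h (p 0) + X 1 * X 2 * h (p 2) +
    X 1 * X 3 * h (p 3) + X 1 * X 4 * h (p 4) + X 3 * X 0 * h (q 0) + X 3 * X 1 * h (q 1) +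
    X 3 * X 2 * h (q 2) + X 3 * X 4 * h (q 4)

theorem sq_dvd_det_normal {R : Type*} [CommRing R] (x y z p0 p2 p4 q0 q2 q4 b s d : R) :
    z ^ 2 ∣ det !![0, z * p0, 0, x + z * q0, z;
      z * p0, z * b, -x + z * p2, z * s, y + z * p4;
      0, -x + z * p2, -2 * z, -y + z * q2, 0;
      x + z * q0, z * s, -y + z * q2, z * d, z * q4;
      z, y + z * p4, 0, z * q4, 0] := by
  refine ⟨- 2*p0*p0*q4*q4*z*z*z + 6*p0*q4*x*y*z - 2*p0*q2*q4*x*z*z - 2*p0*p2*q4*y*z*z +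
    2*p0*p2*q2*q4*z*z*z + 4*p0*q4*s*z*z*z + 4*p0*q0*q4*y*z*z + 4*p0*p4*q4*x*z*z +
    4*p0*p4*q0*q4*z*z*z - 4*d*p0*y*z*z - 4*d*p0*p4*z*z*z - 2*p0*y*y*y + 4*p0*q2*y*y*z -
    2*p0*q2*q2*y*z*z - 2*p0*p4*y*y*z + 4*p0*p4*q2*y*z*z - 2*p0*p4*q2*q2*z*z*z -
    4*b*q4*x*z*z - 4*b*q0*q4*z*z*z - 2*q4*x*x*x + 4*p2*q4*x*x*z - 2*p2*p2*q4*x*z*z -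
    2*q0*q4*x*x*z + 4*p2*q0*q4*x*z*z - 2*p2*p2*q0*q4*z*z*z - 2*q2*x*x*y - 2*p2*x*y*y +
    2*p2*q2*x*y*z - 2*p4*x*x*y - 2*p4*q2*x*x*z - 2*p2*p4*x*y*z + 2*p2*p4*q2*x*z*z -
    2*q0*x*y*y - 2*q0*q2*x*y*z - 2*p2*q0*y*y*z + 2*p2*q0*q2*y*z*z - 6*p4*q0*x*y*z -
    2*p4*q0*q2*x*z*z - 2*p2*p4*q0*y*z*z + 2*p2*p4*q0*q2*z*z*z - 2*p4*p4*x*x*z -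
    4*p4*p4*q0*x*z*z - 2*q0*q0*y*y*z - 4*p4*q0*q0*y*z*z - 2*p4*p4*q0*q0*z*z*z + 2*s*x*y*z
    + 4*p4*s*x*z*z + 4*q0*s*y*z*z + 4*p4*q0*s*z*z*z + 2*b*d*z*z*z + b*y*y*z - 2*b*q2*y*z*z
    + b*q2*q2*z*z*z + d*x*x*z - 2*d*p2*x*z*z + d*p2*p2*z*z*z + 2*q2*s*x*z*z + 2*p2*s*y*z*z
    - 2*p2*q2*s*z*z*z - 2*s*s*z*z*z, ?_⟩
  simp [det_succ_row_zero, Fin.sum_univ_succ, Fin.succAbove]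
  ring

theorem exists_dotProduct_eq {P Q : Fin 5 → ℂ} (h : LinearIndependent ℂ ![P, Q]) (α β : ℂ) :
    ∃ v, P ⬝ᵥ v = α ∧ Q ⬝ᵥ v = β := by
  have hrank : (of ![P, Q]).rank = 2 := by
    have : LinearIndependent ℂ (of ![P, Q]).row := h
    simpa using this.rank_matrix
  have htop : LinearMap.range (of ![P, Q]).mulVecLin = ⊤ :=
    Submodule.eq_top_of_finrank_eq (by simpa [Matrix.rank] using hrank)
  obtain ⟨v, hv⟩ : ![α, β] ∈ LinearMap.range (of ![P, Q]).mulVecLin := htop ▸ Submodule.mem_top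
  refine ⟨v, ?_, ?_⟩
  · simpa [mulVec] using congrFun hv 0
  · simpa [mulVec] using congrFun hv 1

/-- If `x + t y + t² z` spans the kernel of `A + t B` for small `t` and `det (A + t B + u D)`
vanishes to second order in `u`, then `D` vanishes identically on this curve. -/
theorem dotProduct_eq_zero_of_kernel_curve {A B D : Matrix (Fin 5) (Fin 5) ℂ} (hA : A.IsSymm)
    (hB : B.IsSymm) (hD : D.IsSymm) {r : Fin 4 → Fin 5 → ℂ}
    (hr : LinearIndependent ℂ fun j => A *ᵥ r j)
    (hdet : ∀ t : ℂ, ∃ h : ℂ → ℂ, Continuous h ∧ ∀ u, (A + t • B + u • D).det = u ^ 2 * h u)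
    {x y z : Fin 5 → ℂ} (hx : A *ᵥ x = 0) (hy : A *ᵥ y = -(B *ᵥ x)) (hz : A *ᵥ z = -(B *ᵥ y))
    (hBz : B *ᵥ z = 0) :
    x ⬝ᵥ D *ᵥ x = 0 ∧ x ⬝ᵥ D *ᵥ y = 0 ∧ 2 * (x ⬝ᵥ D *ᵥ z) + y ⬝ᵥ D *ᵥ y = 0 ∧
      y ⬝ᵥ D *ᵥ z = 0 ∧ z ⬝ᵥ D *ᵥ z = 0 := by
  have key : ∀ᶠ t : ℂ in nhds 0, x ⬝ᵥ D *ᵥ x + 2 * (x ⬝ᵥ D *ᵥ y) * t +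
      (2 * (x ⬝ᵥ D *ᵥ z) + y ⬝ᵥ D *ᵥ y) * t ^ 2 + 2 * (y ⬝ᵥ D *ᵥ z) * t ^ 3 +
      z ⬝ᵥ D *ᵥ z * t ^ 4 = 0 := by
    filter_upwards [eventually_linearIndependent_mulVec (B := B) hr] with t ht
    obtain ⟨h, hh, hdet⟩ := hdet t
    have hker : (A + t • B) *ᵥ (x + t • y + t ^ 2 • z) = 0 := by
      simp only [mulVec_add, add_mulVec, mulVec_smul, smul_mulVec, hx, hy, hz, hBz, smul_zero]
      module
    have h0 := dotProduct_mulVec_eq_zero_of_det (hA.add (hB.smul t)) ht hker hh hdet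
    simp only [mulVec_add, mulVec_smul, dotProduct_add, add_dotProduct, dotProduct_smul,
      smul_dotProduct, smul_eq_mul, dotProduct_mulVec_comm hD y x, dotProduct_mulVec_comm hD z x,
      dotProduct_mulVec_comm hD z y] at h0
    linear_combination h0
  obtain ⟨h0, h1, h2, h3, h4⟩ := quartic_coeff_eq_zero key
  exact ⟨h0, by simpa using h1, h2, by simpa using h3, h4⟩

/-- A pencil `A + t B` with the kernel curve `x + t y + t² z` takes a standard form in a suitable
basis containing `z, y, x`. -/
theorem exists_basis_gram {A B : Matrix (Fin 5) (Fin 5) ℂ} (hA : A.IsSymm) (hB : B.IsSymm)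
    {x y z : Fin 5 → ℂ} (hx0 : x ≠ 0) (hli : LinearIndependent ℂ ![A *ᵥ y, A *ᵥ z])
    (hx : A *ᵥ x = 0) (hy : B *ᵥ x = -(A *ᵥ y)) (hz : B *ᵥ y = -(A *ᵥ z)) (hBz : B *ᵥ z = 0) :
    ∃ b d : Fin 5 → ℂ, LinearIndependent ℂ ![z, b, y, d, x] ∧
      (of fun i j => ![z, b, y, d, x] i ⬝ᵥ A *ᵥ ![z, b, y, d, x] j) = normalMatrix₁ ∧
      (of fun i j => ![z, b, y, d, x] i ⬝ᵥ B *ᵥ ![z, b, y, d, x] j) = normalMatrix₂ := by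
  obtain ⟨b, hPb, hQb⟩ := exists_dotProduct_eq hli (-1/2) 0
  obtain ⟨d, hPd, hQd⟩ := exists_dotProduct_eq hli 0 (1/2)
  generalize hP : A *ᵥ y = P at *
  generalize hQ : A *ᵥ z = Q at *
  have sA := dotProduct_mulVec_comm hA
  have sB := dotProduct_mulVec_comm hB
  have hPx : x ⬝ᵥ P = 0 := by rw [← hP, sA, hx, dotProduct_zero]
  have hQx : x ⬝ᵥ Q = 0 := by rw [← hQ, sA, hx, dotProduct_zero]
  have hPz : z ⬝ᵥ P = 0 := by
    rw [← neg_eq_zero, ← dotProduct_neg, ← hy, sB, hBz, dotProduct_zero]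
  have hQz : z ⬝ᵥ Q = 0 := by
    rw [← neg_eq_zero, ← dotProduct_neg, ← hz, sB, hBz, dotProduct_zero]
  have hQy : y ⬝ᵥ Q = 0 := by rw [← hQ, sA, hP, hPz]
  have hPy : y ⬝ᵥ P = 0 := by
    rw [← neg_eq_zero, ← dotProduct_neg, ← hy, sB, hz, dotProduct_neg, hQx, neg_zero]
  rw [dotProduct_comm] at hPb hQb hPd hQd
  refine ⟨b + (-(b ⬝ᵥ B *ᵥ b)) • x + (b ⬝ᵥ A *ᵥ b) • y +
      (d ⬝ᵥ B *ᵥ d - 2 * (b ⬝ᵥ A *ᵥ d)) • z,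
    d + (b ⬝ᵥ A *ᵥ b - 2 * (b ⬝ᵥ B *ᵥ d)) • x + (d ⬝ᵥ B *ᵥ d) • y +
      (-(d ⬝ᵥ A *ᵥ d)) • z, ?_, ?_, ?_⟩
  · rw [Fintype.linearIndependent_iff]
    intro c hc
    simp only [Fin.sum_univ_five, cons_val] at hc
    have h1 := congrArg (· ⬝ᵥ P) hc
    have h3 := congrArg (· ⬝ᵥ Q) hc
    simp only [add_dotProduct, smul_dotProduct, smul_eq_mul, hPx, hPy, hPz, hPb, hPd, hQx, hQy,
      hQz, hQb, hQd, zero_dotProduct] at h1 h3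
    have h1 : c 1 = 0 := by linear_combination -2 * h1
    have h3 : c 3 = 0 := by linear_combination 2 * h3
    simp only [h1, h3, zero_smul, add_zero] at hc
    have h02 := congrArg (A *ᵥ ·) hc
    simp only [mulVec_add, mulVec_smul, hP, hQ, hx, smul_zero, add_zero, mulVec_zero] at h02
    obtain ⟨h2, h0⟩ := LinearIndependent.pair_iff.1 hli _ _ (by rw [add_comm]; exact h02)
    simp only [h2, h0, zero_smul, zero_add, smul_eq_zero, hx0, or_false] at hc
    intro i
    fin_cases i <;> assumption
  all_goals
    ext i j
    fin_cases i <;> fin_cases j <;>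
    simp [normalMatrix₁, normalMatrix₂, mulVec_add, mulVec_neg, mulVec_smul, hP, hQ, hx, hy, hz, hBz, hPx, hPy, hPz, hPb, hPd,
      hQx, hQy, hQz, hQb, hQd, sA x, sA y, sA z, sB x, sB y, sB z, sA d b, sB d b] <;> ring

theorem exists_kernel_curve {A B D : Matrix (Fin 5) (Fin 5) ℂ} (hA : A.IsSymm)
    (hB : B.IsSymm) (hD : D.IsSymm) (hss : MatrixSemistable ![A, B, D])
    (hrank : ∀ t : ℂ, (A + t • B).rank ≤ A.rank) {r : Fin 4 → Fin 5 → ℂ}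
    (hr : LinearIndependent ℂ fun j => A *ᵥ r j)
    (hdet : ∀ t : ℂ, ∃ h : ℂ → ℂ, Continuous h ∧ ∀ u, (A + t • B + u • D).det = u ^ 2 * h u)
    {x : Fin 5 → ℂ} (hx0 : x ≠ 0) (hx : A *ᵥ x = 0) :
    ∃ y z, LinearIndependent ℂ ![A *ᵥ y, A *ᵥ z] ∧ B *ᵥ x = -(A *ᵥ y) ∧ B *ᵥ y = -(A *ᵥ z) ∧
      B *ᵥ z = 0 := by
  obtain ⟨v, hv0, hv⟩ := exists_chain hrank hx 6
  have hB0 : B *ᵥ x = -(A *ᵥ v 1) := by rw [hv 0 (by norm_num), hv0, neg_neg]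
  have hB1 : B *ᵥ v 1 = -(A *ᵥ v 2) := by rw [hv 1 (by norm_num), neg_neg]
  have hB2 : B *ᵥ v 2 = -(A *ᵥ v 3) := by rw [hv 2 (by norm_num), neg_neg]
  have hiso := chain_isotropic hA hB (hv0.symm ▸ hx) hv hv
  by_cases h1 : A *ᵥ v 1 = 0
  · have hBx : B *ᵥ x = 0 := by rw [hB0, h1, neg_zero]
    refine (not_semistable_of_common_kernel hA hB hss hx0 hx hBx ?_).elim
    exact (dotProduct_eq_zero_of_kernel_curve hA hB hD hr hdet (y := 0) (z := 0) hx (by simp [hBx])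
      (by simp) (by simp)).1
  by_cases h2 : ∃ c : ℂ, A *ᵥ v 2 = c • A *ᵥ v 1
  · obtain ⟨c, hc⟩ := h2
    have hAy : A *ᵥ (v 1 - c • x) = A *ᵥ v 1 := by simp [mulVec_sub, mulVec_smul, hx]
    have hBy : B *ᵥ (v 1 - c • x) = 0 := by
      simp [mulVec_sub, mulVec_smul, hB0, hB1, hc]
    obtain ⟨hxx, hxy, hyy, -, -⟩ := dotProduct_eq_zero_of_kernel_curve hA hB hD hr hdet
      (y := v 1 - c • x) (z := 0) hx (by rw [hAy, hB0, neg_neg]) (by simp [hBy]) (by simp)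
    refine (not_semistable_of_isotropic_line hA hB hss (v := x) (w := v 1 - c • x)
      (φ := A *ᵥ v 1) (a := 0) (b := -1) (c := 1) (d := 0) ?_ (by simp [hx]) (by simp [hB0])
      (by simp [hAy]) (by simp [hBy]) ?_ ?_ hxx hxy ?_ (by simpa using hyy)).elim
    · rw [LinearIndependent.pair_iff]
      intro s t hst
      have h3 := congrArg (A *ᵥ ·) hst
      simp only [mulVec_add, mulVec_smul, hx, hAy, smul_zero, zero_add, mulVec_zero, smul_eq_zero,
        h1, or_false] at h3
      simp only [h3, zero_smul, add_zero, smul_eq_zero, hx0, or_false] at hst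
      exact ⟨hst, h3⟩
    · simpa [hv0] using hiso 1 0 (by norm_num)
    · have := hiso 1 0 (by norm_num)
      rw [hv0] at this
      simp [this, hiso 1 1]
    · rw [dotProduct_mulVec_comm hD, hxy]
  · have hli : LinearIndependent ℂ ![A *ᵥ v 2, A *ᵥ v 1] :=
      linearIndependent_pair_of_notMem h1 (not_exists.1 h2)
    have h3 : A *ᵥ v 3 ∈ Submodule.span ℂ {A *ᵥ v 2, A *ᵥ v 1} := by
      by_contra h3
      have hli3 : LinearIndependent ℂ ![A *ᵥ v 3, A *ᵥ v 2, A *ᵥ v 1] :=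
        linearIndependent_finCons.2 ⟨hli, by simpa [Set.pair_comm] using h3⟩
      have hk : LinearIndependent ℂ ![x] := by simpa [linearIndependent_unique_iff] using hx0
      have := add_add_le_five (A := A) (x := fun j : Fin 3 => ![v 3, v 2, v 1] j) (k := ![x]) (by
          convert hli3 using 1
          ext j i
          fin_cases j <;> rfl) hk (by simp [hx]) hA (by
          intro i j
          fin_cases i <;> fin_cases j <;> exact hiso _ _ (by norm_num))
      omega
    obtain ⟨b, a, hab⟩ := Submodule.mem_span_pair.1 h3
    refine ⟨v 1 - b • x, v 2 - b • v 1 - a • x, ?_, ?_, ?_, ?_⟩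
    · rw [LinearIndependent.pair_iff] at hli ⊢
      intro s t hst
      simp only [mulVec_sub, mulVec_smul, hx, smul_zero, sub_zero] at hst
      obtain ⟨ht, hs⟩ := hli t (s - t * b) (by rw [← hst]; module)
      exact ⟨by simpa [ht] using hs, ht⟩
    · simp [mulVec_sub, mulVec_smul, hx, hB0]
    · simp only [mulVec_sub, mulVec_smul, hx, hB0, hB1]
      module
    · simp only [mulVec_sub, mulVec_smul, hB0, hB1, hB2, ← hab]
      module

theorem exists_basis_of_det_eq {A B D : Matrix (Fin 5) (Fin 5) ℂ} (hA : A.IsSymm)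
    (hB : B.IsSymm) (hD : D.IsSymm) (hss : MatrixSemistable ![A, B, D])
    (hrank : ∀ t : ℂ, (A + t • B).rank ≤ A.rank)
    (hdet : ∀ t : ℂ, ∃ h : ℂ → ℂ, Continuous h ∧ ∀ u, (A + t • B + u • D).det = u ^ 2 * h u) :
    ∃ f : Fin 5 → Fin 5 → ℂ, LinearIndependent ℂ f ∧
      (of fun i j => f i ⬝ᵥ A *ᵥ f j) = normalMatrix₁ ∧
      (of fun i j => f i ⬝ᵥ B *ᵥ f j) = normalMatrix₂ ∧
      ∃ c : ℂ, c ≠ 0 ∧ ∃ p q : Fin 5 → ℂ,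
        (of fun i j => f i ⬝ᵥ D *ᵥ f j) = c • normalMatrix₃ p q := by
  have hdetA : A.det = 0 := by
    obtain ⟨h, -, h0⟩ := hdet 0
    simpa using h0 0
  obtain ⟨x, hx0, hx⟩ := exists_mulVec_eq_zero_iff.2 hdetA
  have hker : LinearMap.ker A.mulVecLin ≤ Submodule.span ℂ {x} := by
    intro y hy
    by_contra hmem
    refine false_of_two_le_finrank_ker hA hB hss hrank (linearIndependent_pair_of_notMem hx0
      fun c hc => hmem ?_) (by simpa using hy) hx
    exact Submodule.mem_span_singleton.2 ⟨c, hc.symm⟩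
  have hrk : 4 ≤ A.rank := by
    have h1 := A.mulVecLin.finrank_range_add_finrank_ker
    have h2 := Submodule.finrank_mono hker
    rw [finrank_span_singleton hx0] at h2
    rw [Matrix.rank]
    simp only [Module.finrank_fintype_fun_eq_card, Fintype.card_fin] at h1
    omega
  obtain ⟨r, hr⟩ := exists_linearIndependent_mulVec A
  have hr := hr.comp (Fin.castLE hrk) (Fin.castLE_injective hrk)
  obtain ⟨y, z, hli, hy, hz, hBz⟩ :=
    exists_kernel_curve hA hB hD hss hrank (r := r ∘ Fin.castLE hrk) hr hdet hx0 hx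
  obtain ⟨hxx, hxy, hxz, hyz, hzz⟩ := dotProduct_eq_zero_of_kernel_curve hA hB hD
    (r := r ∘ Fin.castLE hrk) hr hdet hx (by rw [hy, neg_neg]) (by rw [hz, neg_neg]) hBz
  obtain ⟨b, d, hf, hfA, hfB⟩ := exists_basis_gram hA hB hx0 hli hx hy hz hBz
  have sD := dotProduct_mulVec_comm hD
  have hyy : y ⬝ᵥ D *ᵥ y = -(2 * (x ⬝ᵥ D *ᵥ z)) := by linear_combination hxz
  by_cases h0 : x ⬝ᵥ D *ᵥ z = 0
  · simp only [h0, mul_zero, neg_zero] at hyy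
    refine (not_semistable_of_isotropic_plane hss (v := ![z, y, x]) ?_ ?_ ?_ ?_).elim
    · have := hf.comp ![0, 2, 4] (by decide)
      convert this using 1
      ext i
      fin_cases i <;> rfl
    · intro i j
      have := congrFun₂ hfA (![0, 2, 4] i) (![0, 2, 4] j)
      fin_cases i <;> fin_cases j <;> simpa [normalMatrix₁, normalMatrix₂] using this
    · intro i j
      have := congrFun₂ hfB (![0, 2, 4] i) (![0, 2, 4] j)
      fin_cases i <;> fin_cases j <;> simpa [normalMatrix₁, normalMatrix₂] using this
    · intro i j
      fin_cases i <;> fin_cases j <;>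
        simp [hxx, hxy, h0, hyy, hyz, hzz, sD z, sD y x]
  · set c := 2 * (x ⬝ᵥ D *ᵥ z) with hcdef
    have hc' : c ≠ 0 := by simpa [hcdef] using h0
    have hxz' : x ⬝ᵥ D *ᵥ z = c / 2 := by rw [hcdef]; ring
    refine ⟨_, hf, hfA, hfB, c, hc',
      fun j => ![2, 1, 2, 2, 2] j / c * (b ⬝ᵥ D *ᵥ ![z, b, y, d, x] j),
      fun j => ![2, 0, 2, 1, 2] j / c * (d ⬝ᵥ D *ᵥ ![z, b, y, d, x] j), ?_⟩
    ext i j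
    fin_cases i <;> fin_cases j <;>
      simp [normalMatrix₃, hxx, hxy, hxz', hyy, hyz, hzz, sD z, sD y x, sD y d, sD y b, sD x b,
        sD x d, sD d b] <;> field_simp

/-- A basis of `ℂ³` adapted to a linear form, whose first vector maximizes `ρ` on the kernel. -/
theorem exists_basis_adapted (ℓ : (Fin 3 → ℂ) →ₗ[ℂ] ℂ) (hℓ : ℓ ≠ 0) (ρ : (Fin 3 → ℂ) → ℕ)
    {N : ℕ} (hρ : ∀ s, ρ s ≤ N) :
    ∃ s : Fin 3 → Fin 3 → ℂ, LinearIndependent ℂ s ∧ ℓ (s 0) = 0 ∧ ℓ (s 1) = 0 ∧ ℓ (s 2) = 1 ∧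
      ∀ t : ℂ, ρ (s 0 + t • s 1) ≤ ρ (s 0) := by
  obtain ⟨s2, hs2⟩ : ∃ s, ℓ s = 1 := LinearMap.surjective hℓ 1
  have hker : Module.finrank ℂ (LinearMap.ker ℓ) = 2 := by
    have h := ℓ.finrank_range_add_finrank_ker
    rw [LinearMap.range_eq_top.2 (LinearMap.surjective hℓ)] at h
    simp at h
    omega
  let S : Set ℕ := {n | ∃ s, ℓ s = 0 ∧ s ≠ 0 ∧ ρ s = n}
  have hS : S.Nonempty := by
    have : LinearMap.ker ℓ ≠ ⊥ := fun h => by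
      rw [h, finrank_bot] at hker
      omega
    obtain ⟨s, hs, hs0⟩ := Submodule.exists_mem_ne_zero_of_ne_bot this
    exact ⟨ρ s, s, hs, hs0, rfl⟩
  have hbdd : BddAbove S := ⟨N, by rintro _ ⟨s, -, -, rfl⟩; exact hρ s⟩
  obtain ⟨s0, hs0, hs0', hmax⟩ := Nat.sSup_mem hS hbdd
  have hle : ¬ LinearMap.ker ℓ ≤ Submodule.span ℂ {s0} := fun h => by
    have := Submodule.finrank_mono h
    rw [hker, finrank_span_singleton hs0'] at this
    omega
  obtain ⟨s1, hs1, hs1'⟩ := SetLike.not_le_iff_exists.1 hle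
  have hind : ∀ a b : ℂ, a • s0 + b • s1 = 0 → a = 0 ∧ b = 0 := by
    intro a b hab
    have hb : b = 0 := by
      by_contra hb
      refine hs1' (Submodule.mem_span_singleton.2 ⟨-(b⁻¹ * a), ?_⟩)
      have : b⁻¹ • (a • s0 + b • s1) = 0 := by rw [hab, smul_zero]
      rw [smul_add, smul_smul, smul_smul, inv_mul_cancel₀ hb, one_smul] at this
      rw [neg_smul, eq_comm]
      exact eq_neg_of_add_eq_zero_right this
    simpa [hb, hs0'] using hab
  have hs1 : ℓ s1 = 0 := hs1
  refine ⟨![s0, s1, s2], ?_, hs0, hs1, hs2, fun t => ?_⟩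
  · rw [Fintype.linearIndependent_iff]
    intro c hc
    simp only [Fin.sum_univ_three, cons_val] at hc
    have h2 := congrArg ℓ hc
    simp only [map_add, map_smul, hs0, hs1, hs2, smul_eq_mul, mul_zero, mul_one, zero_add,
      map_zero] at h2
    obtain ⟨h0, h1⟩ := hind (c 0) (c 1) (by simpa [h2] using hc)
    intro i
    fin_cases i <;> assumption
  · refine (le_csSup hbdd ⟨s0 + t • s1, by simp [hs0, hs1], fun h => ?_, rfl⟩).trans_eq hmax.symm
    exact one_ne_zero (hind 1 t (by rwa [one_smul])).1

theorem exists_eq_sum_of_isHomogeneous_one {n : ℕ} {l : MvPolynomial (Fin n) ℂ}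
    (hl : l.IsHomogeneous 1) : ∃ c : Fin n → ℂ, l = ∑ i, C (c i) * X i := by
  rw [← mem_homogeneousSubmodule, homogeneousSubmodule_one_eq_span_X,
    Submodule.mem_span_range_iff_exists_fun] at hl
  obtain ⟨c, rfl⟩ := hl
  exact ⟨c, by simp [smul_eq_C_mul]⟩

theorem isHomogeneous_sum_C_mul_X {n : ℕ} (c : Fin n → ℂ) :
    (∑ i, C (c i) * X i : MvPolynomial (Fin n) ℂ).IsHomogeneous 1 :=
  IsHomogeneous.sum _ _ _ fun i _ => by
    simpa using (isHomogeneous_C (Fin n) (c i)).mul (isHomogeneous_X ℂ i)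

theorem eval_netDisc (Q1 Q2 Q3 : Quin) (s : Fin 3 → ℂ) :
    eval s (netDisc Q1 Q2 Q3) =
      (∑ i, s i • ![quadMatrix Q1, quadMatrix Q2, quadMatrix Q3] i).det := by
  rw [netDisc, RingHom.map_det]
  congr 1
  ext i j
  simp [Fin.sum_univ_three, mul_comm]

theorem map_substMap_span (g : Matrix (Fin 5) (Fin 5) ℂ)
    (A : Fin 3 → Matrix (Fin 5) (Fin 5) ℂ) :
    Submodule.map (substMap g) (Submodule.span ℂ (Set.range fun k => quadForm (A k))) =
      Submodule.span ℂ (Set.range fun k => quadForm (gᵀ * A k * g)) := by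
  rw [Submodule.map_span, ← Set.range_comp]
  simp only [Function.comp_def, substMap_quadForm]

theorem span_range_quadForm_sum (A : Fin 3 → Matrix (Fin 5) (Fin 5) ℂ) {s : Fin 3 → Fin 3 → ℂ}
    (hs : LinearIndependent ℂ s) :
    Submodule.span ℂ (Set.range fun k => quadForm (∑ i, s k i • A i)) =
      Submodule.span ℂ (Set.range fun k => quadForm (A k)) := by
  have h : (fun k => quadForm (∑ i, s k i • A i)) =
      Fintype.linearCombination ℂ (fun k => quadForm (A k)) ∘ s := by
    ext1 k
    simp [Fin.sum_univ_three, quadForm_add, quadForm_smul, Fintype.linearCombination_apply]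
  rw [h, Set.range_comp, ← Submodule.map_span,
    hs.span_eq_top_of_card_eq_finrank' (by simp), Submodule.map_top,
    Fintype.range_linearCombination]

theorem span_triple {V : Type*} [AddCommGroup V] [Module ℂ V] (x y z : V) :
    Submodule.span ℂ {x, y, z} = Submodule.span ℂ (Set.range ![x, y, z]) := by
  rw [range_cons, range_cons, range_cons, range_empty, Set.union_empty]
  rfl

theorem exists_normal_form_of_sq_dvd {Λ : Submodule ℂ Quin} (hss : Semistable Λ) {Q1 Q2 Q3 : Quin}
    (hQ1 : Q1.IsHomogeneous 2) (hQ2 : Q2.IsHomogeneous 2) (hQ3 : Q3.IsHomogeneous 2)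
    (hspan : Submodule.span ℂ {Q1, Q2, Q3} = Λ) {l : MvPolynomial (Fin 3) ℂ} (hl0 : l ≠ 0)
    (hl : l.IsHomogeneous 1) (hdvd : l ^ 2 ∣ netDisc Q1 Q2 Q3) :
    ∃ (g : GeneralLinearGroup (Fin 5) ℂ) (p q : Fin 5 → ℂ),
      Submodule.map (substMap (g : Matrix (Fin 5) (Fin 5) ℂ)) Λ = Submodule.span ℂ
        {quadForm normalMatrix₁, quadForm normalMatrix₂, quadForm (normalMatrix₃ p q)} := by
  obtain ⟨c, rfl⟩ := exists_eq_sum_of_isHomogeneous_one hl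
  obtain ⟨P, hP⟩ := hdvd
  let M : Fin 3 → Matrix (Fin 5) (Fin 5) ℂ := ![quadMatrix Q1, quadMatrix Q2, quadMatrix Q3]
  have hM : ∀ k, (M k).IsSymm := by
    intro k
    fin_cases k <;> exact quadMatrix_isSymm _
  have hMsymm : ∀ s : Fin 3 → ℂ, (∑ i, s i • M i).IsSymm := fun s => by
    rw [Fin.sum_univ_three]
    exact (((hM 0).smul _).add ((hM 1).smul _)).add ((hM 2).smul _)
  have hΛ : Submodule.span ℂ (Set.range fun k => quadForm (M k)) = Λ := by
    rw [← hspan, span_triple]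
    congr 2
    ext1 k
    fin_cases k
    · exact quadForm_quadMatrix hQ1
    · exact quadForm_quadMatrix hQ2
    · exact quadForm_quadMatrix hQ3
  let ℓ : (Fin 3 → ℂ) →ₗ[ℂ] ℂ := Fintype.linearCombination ℂ c
  have hℓ : ∀ s, eval s (∑ i, C (c i) * X i) = ℓ s := fun s => by
    simp [ℓ, Fintype.linearCombination_apply, mul_comm]
  have hℓ0 : ℓ ≠ 0 := fun h => hl0 (MvPolynomial.funext fun s => by rw [hℓ, h]; simp)
  obtain ⟨s, hs, hs0, hs1, hs2, hrank⟩ := exists_basis_adapted ℓ hℓ0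
    (fun s => (∑ i, s i • M i).rank) (N := 5) fun s => by
      simpa using rank_le_card_width (∑ i, s i • M i)
  set A : Fin 3 → Matrix (Fin 5) (Fin 5) ℂ := fun k => ∑ i, s k i • M i with hAdef
  have hspanA : Λ = Submodule.span ℂ (Set.range fun k => quadForm (A k)) := by
    rw [← hΛ, span_range_quadForm_sum M hs]
  have hcomb : ∀ t u : ℂ, A 0 + t • A 1 + u • A 2 = ∑ i, (s 0 + t • s 1 + u • s 2) i • M i := by
    intro t u
    simp only [hAdef, Fin.sum_univ_three, Pi.add_apply, Pi.smul_apply, smul_eq_mul]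
    module
  have hss' : MatrixSemistable ![A 0, A 1, A 2] := by
    have := hss.matrixSemistable hspanA
    convert this using 1
    ext1 k
    fin_cases k <;> rfl
  obtain ⟨f, hf, hf0, hf1, b, hb, p, q, hf2⟩ := exists_basis_of_det_eq (hMsymm (s 0))
    (hMsymm (s 1)) (hMsymm (s 2)) hss' (fun t => by
      have := hcomb t 0
      simp only [zero_smul, add_zero] at this
      exact this ▸ hrank t) fun t => ⟨fun u => eval (s 0 + t • s 1 + u • s 2) P,
      (MvPolynomial.continuous_eval P).comp (by fun_prop), fun u => by
      have h := congrArg (eval (s 0 + t • s 1 + u • s 2)) hP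
      rw [eval_netDisc, ← hcomb, map_mul, map_pow, hℓ] at h
      simpa [hs0, hs1, hs2] using h⟩
  obtain ⟨g, hg⟩ := isUnit_of_transpose hf
  have hgram : ∀ k, (g : Matrix (Fin 5) (Fin 5) ℂ)ᵀ * A k * g =
      of fun i j => f i ⬝ᵥ A k *ᵥ f j := by
    intro k
    ext i j
    rw [hg, transpose_mul_mul_apply, of_apply]
  refine ⟨g, p, q, ?_⟩
  rw [hspanA, map_substMap_span]
  simp only [hgram]
  have : (fun k => quadForm (of fun i j => f i ⬝ᵥ A k *ᵥ f j)) =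
      ![quadForm normalMatrix₁, quadForm normalMatrix₂, b • quadForm (normalMatrix₃ p q)] := by
    ext1 k
    fin_cases k
    · exact congrArg quadForm hf0
    · exact congrArg quadForm hf1
    · exact (congrArg quadForm hf2).trans (quadForm_smul _ _)
  rw [this, ← span_triple]
  simp only [Submodule.span_insert, Submodule.span_singleton_smul_eq hb.isUnit]

theorem sq_dvd_netDisc_of_normal_form {Λ : Submodule ℂ Quin} {Q1 Q2 Q3 : Quin}
    (hQ1 : Q1.IsHomogeneous 2) (hQ2 : Q2.IsHomogeneous 2) (hQ3 : Q3.IsHomogeneous 2)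
    (hli : LinearIndependent ℂ ![Q1, Q2, Q3]) (hspan : Submodule.span ℂ {Q1, Q2, Q3} = Λ)
    (g : GeneralLinearGroup (Fin 5) ℂ) (p q : Fin 5 → ℂ)
    (hg : Submodule.map (substMap (g : Matrix (Fin 5) (Fin 5) ℂ)) Λ = Submodule.span ℂ
      {quadForm normalMatrix₁, quadForm normalMatrix₂, quadForm (normalMatrix₃ p q)}) :
    ∃ l : MvPolynomial (Fin 3) ℂ, l ≠ 0 ∧ l.IsHomogeneous 1 ∧ l ^ 2 ∣ netDisc Q1 Q2 Q3 := by
  set G : Matrix (Fin 5) (Fin 5) ℂ := g.val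
  have hGu : IsUnit G := g.isUnit
  let Q : Fin 3 → Quin := ![Q1, Q2, Q3]
  let N : Fin 3 → Matrix (Fin 5) (Fin 5) ℂ := ![normalMatrix₁, normalMatrix₂, normalMatrix₃ p q]
  have hQ : ∀ i, (Q i).IsHomogeneous 2 := by
    intro i
    fin_cases i <;> assumption
  have hN : ∀ k, (N k).IsSymm := by
    intro k
    fin_cases k
    · exact normalMatrix₁_isSymm
    · exact normalMatrix₂_isSymm
    · exact normalMatrix₃_isSymm p q
  have hmem : ∀ i, ∃ T : Fin 3 → ℂ, Gᵀ * quadMatrix (Q i) * G = ∑ k, T k • N k := by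
    intro i
    have h1 : substMap G (Q i) ∈ Submodule.map (substMap G) Λ := by
      refine Submodule.mem_map_of_mem ?_
      rw [← hspan, span_triple]
      exact Submodule.subset_span ⟨i, rfl⟩
    rw [hg, span_triple, Submodule.mem_span_range_iff_exists_fun] at h1
    obtain ⟨T, hT⟩ := h1
    refine ⟨T, ?_⟩
    rw [← quadForm_quadMatrix (hQ i), substMap_quadForm] at hT
    have h2 : quadForm (∑ k, T k • N k) = quadForm (Gᵀ * quadMatrix (Q i) * G) := by
      rw [← hT]
      simp [N, Fin.sum_univ_three, quadForm_add, quadForm_smul]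
    have hs1 : (∑ k, T k • N k).IsSymm := by
      rw [Fin.sum_univ_three]
      exact (((hN 0).smul _).add ((hN 1).smul _)).add ((hN 2).smul _)
    have hs2 : (Gᵀ * quadMatrix (Q i) * G).IsSymm := by
      rw [IsSymm, transpose_mul, transpose_mul, transpose_transpose, (quadMatrix_isSymm _).eq,
        Matrix.mul_assoc]
    rw [← quadMatrix_quadForm hs1, h2, quadMatrix_quadForm hs2]
  choose T hT using hmem
  let y : Fin 3 → MvPolynomial (Fin 3) ℂ := fun k => ∑ i, C (T i k) * X i
  have hy2 : y 2 ≠ 0 := by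
    intro h0
    have hT2 : ∀ i, T i 2 = 0 := by
      intro i
      have := congrArg (eval (Pi.single i 1)) h0
      simpa [y, Pi.single_apply] using this
    have hdet : (of T).det = 0 := det_eq_zero_of_column_eq_zero 2 hT2
    obtain ⟨c, hc0, hc⟩ := exists_vecMul_eq_zero_iff.2 hdet
    refine hc0 (funext (Fintype.linearIndependent_iff.1 hli c ?_))
    have h1 : Gᵀ * (∑ i, c i • quadMatrix (Q i)) * G = 0 := by
      have hk : ∀ k, ∑ i, c i * T i k = 0 := fun k => by
        simpa [vecMul, dotProduct] using congrFun hc k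
      simp only [Matrix.mul_sum, Matrix.sum_mul, Matrix.mul_smul, Matrix.smul_mul, hT,
        Finset.smul_sum, smul_smul]
      rw [Finset.sum_comm]
      simp only [← Finset.sum_smul, hk, zero_smul, Finset.sum_const_zero]
    have h2 : ∑ i, c i • quadMatrix (Q i) = 0 := by
      have hGt : IsUnit Gᵀ := (isUnit_transpose _).2 hGu
      rwa [hGu.mul_left_eq_zero, hGt.mul_right_eq_zero] at h1
    have h3 : quadForm (∑ i, c i • quadMatrix (Q i)) = ∑ i, c i • Q i := by
      simp [Fin.sum_univ_three, quadForm_add, quadForm_smul, quadForm_quadMatrix, hQ]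
    change ∑ i, c i • Q i = 0
    rw [← h3, h2]
    simp [quadForm]
  refine ⟨y 2, hy2, isHomogeneous_sum_C_mul_X _, ?_⟩
  let CC : Matrix (Fin 5) (Fin 5) ℂ →+* Matrix (Fin 5) (Fin 5) (MvPolynomial (Fin 3) ℂ) :=
    (C : ℂ →+* MvPolynomial (Fin 3) ℂ).mapMatrix
  have hdisc : netDisc Q1 Q2 Q3 =
      (∑ i, (X i : MvPolynomial (Fin 3) ℂ) • CC (quadMatrix (Q i))).det := by
    rw [netDisc]
    congr 1
    ext1 i j
    simp [CC, Q, Fin.sum_univ_three, mul_comm]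
  have hconj : CC Gᵀ * (∑ i, (X i : MvPolynomial (Fin 3) ℂ) • CC (quadMatrix (Q i))) * CC G =
      ∑ k, y k • CC (N k) := by
    simp only [Matrix.mul_sum, Matrix.sum_mul, Matrix.mul_smul, Matrix.smul_mul, ← map_mul, hT]
    simp only [y, Finset.sum_smul, map_sum, Finset.smul_sum]
    rw [Finset.sum_comm]
    refine Finset.sum_congr rfl fun k _ => Finset.sum_congr rfl fun i _ => ?_
    ext1 a b
    simp [CC]
    ring
  have hunit : ∀ H : Matrix (Fin 5) (Fin 5) ℂ, IsUnit H → IsUnit (CC H).det := fun H hH =>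
    (isUnit_iff_isUnit_det _).1 (hH.map CC)
  have hdvd : y 2 ^ 2 ∣ (∑ k, y k • CC (N k)).det := by
    obtain ⟨h, h2, hC⟩ : ∃ h : MvPolynomial (Fin 3) ℂ, h * 2 = 1 ∧ ∀ r, C (r / 2) = C r * h := by
      refine ⟨C (1 / 2), ?_, fun r => ?_⟩
      · rw [← map_ofNat C, ← C_mul]
        norm_num
      · rw [← C_mul, mul_one_div]
    have hdet := sq_dvd_det_normal (h * y 0) (h * y 1) (h * y 2) (C (p 0)) (C (p 2)) (C (p 4))
      (C (q 0)) (C (q 2)) (C (q 4)) (2 * C (p 1)) (C (p 3) + C (q 1)) (2 * C (q 3))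
    rw [mul_pow] at hdet
    convert (dvd_mul_left _ _).trans hdet using 2
    ext1 a b
    fin_cases a <;> fin_cases b <;>
      simp [CC, N, Fin.sum_univ_three, normalMatrix₁, normalMatrix₂, normalMatrix₃, hC, add_div,
        neg_div, -one_div] <;>
      first
      | ring1
      | linear_combination -y 2 * h2
      | linear_combination -(y 2 * C (p 1)) * h2
      | linear_combination -(y 2 * C (q 3)) * h2
  rw [← hconj, det_mul, det_mul, ← hdisc] at hdvd
  rw [(hunit G hGu).dvd_mul_right, (hunit Gᵀ ((isUnit_transpose _).2 hGu)).dvd_mul_left] at hdvd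
  exact hdvd

end

/-- The discriminant of a semistable net has a double line if and only if
the net is projectively equivalent to `(ad − bc, be − cd, ae − c² + bL1 + dL2)` for some
linear forms `L1, L2`. -/
theorem disc_double_line_iff (Λ : Submodule ℂ Quin) (hΛ : IsNet Λ) (hss : Semistable Λ)
    (Q1 Q2 Q3 : Quin) (hQ1 : Q1 ∈ Λ) (hQ2 : Q2 ∈ Λ) (hQ3 : Q3 ∈ Λ)
    (hli : LinearIndependent ℂ ![Q1, Q2, Q3])
    (hspan : Submodule.span ℂ {Q1, Q2, Q3} = Λ) :
    (∃ l : MvPolynomial (Fin 3) ℂ, l ≠ 0 ∧ l.IsHomogeneous 1 ∧ l ^ 2 ∣ netDisc Q1 Q2 Q3) ↔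
    (∃ (g : Matrix.GeneralLinearGroup (Fin 5) ℂ) (L1 L2 : Quin),
      L1.IsHomogeneous 1 ∧ L2.IsHomogeneous 1 ∧
      Submodule.map (substMap (g : Matrix (Fin 5) (Fin 5) ℂ)) Λ =
        Submodule.span ℂ
          {(MvPolynomial.X 0 * MvPolynomial.X 3 - MvPolynomial.X 1 * MvPolynomial.X 2 : Quin),
           MvPolynomial.X 1 * MvPolynomial.X 4 - MvPolynomial.X 2 * MvPolynomial.X 3,
           MvPolynomial.X 0 * MvPolynomial.X 4 - MvPolynomial.X 2 ^ 2 +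
             MvPolynomial.X 1 * L1 + MvPolynomial.X 3 * L2}) := by
  rw [← quadForm_normalMatrix₁, ← quadForm_normalMatrix₂]
  have h1 := hΛ.2 Q1 hQ1
  have h2 := hΛ.2 Q2 hQ2
  have h3 := hΛ.2 Q3 hQ3
  constructor
  · rintro ⟨l, hl0, hl, hdvd⟩
    obtain ⟨g, p, q, hg⟩ := exists_normal_form_of_sq_dvd hss h1 h2 h3 hspan hl0 hl hdvd
    refine ⟨g, ∑ i, C (p i) * X i, ∑ i, C (q i) * X i, isHomogeneous_sum_C_mul_X p,
      isHomogeneous_sum_C_mul_X q, ?_⟩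
    rw [← quadForm_normalMatrix₃]
    exact hg
  · rintro ⟨g, L1, L2, hL1, hL2, hg⟩
    obtain ⟨p, rfl⟩ := exists_eq_sum_of_isHomogeneous_one hL1
    obtain ⟨q, rfl⟩ := exists_eq_sum_of_isHomogeneous_one hL2
    rw [← quadForm_normalMatrix₃] at hg
    exact sq_dvd_netDisc_of_normal_form h1 h2 h3 hli hspan g p q hg
end
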